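/- arXiv:1204.5332 — 4 statements merged into one kernel-verified Lean document; each statement's English description precedes it below -/
import Mathlib

section
/- Let Ω ⊆ ℝ² be a nonempty bounded open set, let 2 < p < ∞, and let 0 < λ < λ_p. Then there exists a constant C > 0 such that for every u ∈ C_c^∞(Ω), ∫_Ω |∇u(x)|² dx − λ (∫_Ω |u(x)|^p dx)^{2/p} ≥ C ‖u‖_Orl², where ‖u‖_Orl = inf{ k > 0 : ∫_Ω ( e^{4π u(x)²/k²} − 1 ) dx ≤ 1 }. -/
open MeasureTheory Real Set Filter
open scoped ENNReal

noncomputable section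

abbrev E2 := EuclideanSpace ℝ (Fin 2)

/-- `u ∈ C_c^∞(Ω)`: smooth with compact support contained in `Ω`. -/
def IsTestFun (Ω : Set E2) (u : E2 → ℝ) : Prop :=
  ContDiff ℝ (⊤ : ℕ∞) u ∧ IsCompact (tsupport u) ∧ tsupport u ⊆ Ω

/-- `Ω*`: the open disk centered at the origin with the same area as `Ω`. -/
def symDisk (Ω : Set E2) : Set E2 := Metric.ball 0 (Real.sqrt ((volume Ω).toReal / π))

/-- `λ_p`: the infimum of `∫_{Ω*} |∇u|²` over `u ∈ C_c^∞(Ω*)` with `‖u‖_{L^p(Ω*)} = 1`. -/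
def lambdaP (Ω : Set E2) (p : ℝ) : ℝ :=
  sInf {c : ℝ | ∃ u : E2 → ℝ, IsTestFun (symDisk Ω) u ∧
    (∫ x in symDisk Ω, |u x| ^ p) ^ (1 / p) = 1 ∧
    c = ∫ x in symDisk Ω, ‖fderiv ℝ u x‖ ^ 2}

/-- The Luxemburg (Orlicz) norm associated with `s ↦ e^{4πs²} - 1` on a set `Ω`. -/
def orlNorm (Ω : Set E2) (u : E2 → ℝ) : ℝ :=
  sInf {k : ℝ | 0 < k ∧ (∫ x in Ω, (Real.exp (4 * π * u x ^ 2 / k ^ 2) - 1)) ≤ 1}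

open scoped Pointwise in
/-- The Brunn–Minkowski inequality on the line for compact sets. -/
lemma volume_add_volume_le_of_isCompact {K L : Set ℝ} (hK : IsCompact K) (hL : IsCompact L)
    (hK' : K.Nonempty) (hL' : L.Nonempty) : volume K + volume L ≤ volume (K + L) := by
  obtain ⟨a, haK, ha⟩ := hK.exists_isMaxOn hK' continuous_id.continuousOn
  obtain ⟨b, hbL, hb⟩ := hL.exists_isMinOn hL' continuous_id.continuousOn
  have ha' : ∀ x ∈ K, x ≤ a := fun x hx => ha hx
  have hb' : ∀ x ∈ L, b ≤ x := fun x hx => hb hx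
  set S : Set ℝ := (fun h => h + (-b)) ⁻¹' K
  set T : Set ℝ := (fun h => h + (-a)) ⁻¹' L
  have hS : volume S = volume K := measure_preimage_add_right _ _ _
  have hT : volume T = volume L := measure_preimage_add_right _ _ _
  have hTm : MeasurableSet T := (measurable_id.add_const (-a)) hL.measurableSet
  have hsub : S ∪ T ⊆ K + L := by
    rintro x (hx | hx)
    · exact ⟨x + -b, hx, b, hbL, by ring⟩
    · exact ⟨a, haK, x + -a, hx, by ring⟩
  have hint : S ∩ T ⊆ {a + b} := by
    rintro x ⟨hx, hx'⟩
    have h1 := ha' _ hx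
    have h2 := hb' _ hx'
    simp only [mem_singleton_iff]
    linarith
  calc volume K + volume L = volume (S ∪ T) := by
        rw [← hS, ← hT, measure_union₀ hTm.nullMeasurableSet]
        exact measure_mono_null hint (by simp)
    _ ≤ _ := measure_mono hsub

open scoped Pointwise in
/-- The Brunn–Minkowski inequality on the line. -/
lemma volume_add_volume_le {A B : Set ℝ} (hA : MeasurableSet A) (hB : MeasurableSet B)
    (hA' : A.Nonempty) (hB' : B.Nonempty) : volume A + volume B ≤ volume (A + B) := by
  obtain ⟨a, ha⟩ := hA'
  obtain ⟨b, hb⟩ := hB'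
  have key : ∀ K ⊆ A, IsCompact K → ∀ L ⊆ B, IsCompact L →
      volume K + volume L ≤ volume (A + B) := by
    intro K hKA hK L hLB hL
    calc volume K + volume L ≤ volume (insert a K) + volume (insert b L) := by
          gcongr <;> exact subset_insert _ _
      _ ≤ volume (insert a K + insert b L) :=
          volume_add_volume_le_of_isCompact (hK.insert a) (hL.insert b)
            (insert_nonempty _ _) (insert_nonempty _ _)
      _ ≤ _ := measure_mono (Set.add_subset_add (insert_subset ha hKA) (insert_subset hb hLB))
  rw [hA.measure_eq_iSup_isCompact, hB.measure_eq_iSup_isCompact]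
  simp only [iSup_and']
  exact ENNReal.biSup_add_biSup_le' ⟨∅, empty_subset _, isCompact_empty⟩
    ⟨∅, empty_subset _, isCompact_empty⟩ fun K hK L hL => key K hK.1 hK.2 L hL.1 hL.2

/-- The length of the vertical slice of a planar set. -/
def sliceLength (S : Set (ℝ × ℝ)) (x : ℝ) : ℝ := (volume (Prod.mk x ⁻¹' S)).toReal

lemma sliceLength_nonneg (S : Set (ℝ × ℝ)) (x : ℝ) : 0 ≤ sliceLength S x := ENNReal.toReal_nonneg

lemma exists_volume_slice_le {S : Set (ℝ × ℝ)} (hS : Bornology.IsBounded S) :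
    ∃ M : ℝ, 0 ≤ M ∧ ∀ x, volume (Prod.mk x ⁻¹' S) ≤ ENNReal.ofReal M := by
  obtain ⟨R, hR⟩ := hS.subset_closedBall 0
  refine ⟨2 * |R|, by positivity, fun x => ?_⟩
  calc volume (Prod.mk x ⁻¹' S) ≤ volume (Metric.closedBall (0 : ℝ) |R|) := by
        refine measure_mono fun y hy => ?_
        have := hR hy
        simp only [mem_closedBall_zero_iff, Prod.norm_mk] at this ⊢
        exact (le_max_right _ _).trans (this.trans (le_abs_self R))
    _ = _ := by rw [Real.volume_closedBall]

lemma volume_slice_ne_top {S : Set (ℝ × ℝ)} (hS : Bornology.IsBounded S) (x : ℝ) :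
    volume (Prod.mk x ⁻¹' S) ≠ ∞ := by
  obtain ⟨M, -, hM⟩ := exists_volume_slice_le hS
  exact ne_top_of_le_ne_top ENNReal.ofReal_ne_top (hM x)

lemma bddAbove_sliceLength {S : Set (ℝ × ℝ)} (hS : Bornology.IsBounded S) :
    BddAbove (range (sliceLength S)) := by
  obtain ⟨M, hM0, hM⟩ := exists_volume_slice_le hS
  refine ⟨M, ?_⟩
  rintro _ ⟨x, rfl⟩
  exact ENNReal.toReal_le_of_le_ofReal hM0 (hM x)

lemma measurable_sliceLength {S : Set (ℝ × ℝ)} (hS : MeasurableSet S) :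
    Measurable (sliceLength S) :=
  (measurable_measure_prodMk_left hS).ennreal_toReal

lemma lintegral_volume_lt_sliceLength {S : Set (ℝ × ℝ)} (hS : MeasurableSet S)
    (hb : Bornology.IsBounded S) {c : ℝ} (hc : 0 < c) :
    ∫⁻ τ in Ioi (0 : ℝ), volume {x | τ < sliceLength S x / c} =
      volume S / ENNReal.ofReal c := by
  rw [← lintegral_eq_lintegral_meas_lt volume
    (Eventually.of_forall fun x => div_nonneg (sliceLength_nonneg S x) hc.le)
    ((measurable_sliceLength hS).div_const c).aemeasurable, Measure.volume_eq_prod,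
    Measure.prod_apply hS, div_eq_mul_inv, ← lintegral_mul_const]
  · refine lintegral_congr fun x => ?_
    rw [ENNReal.ofReal_div_of_pos hc, sliceLength, ENNReal.ofReal_toReal (volume_slice_ne_top hb x),
      div_eq_mul_inv]
  · exact measurable_measure_prodMk_left hS

lemma sliceLength_iSup_pos {S : Set (ℝ × ℝ)} (hS : IsOpen S) (hb : Bornology.IsBounded S)
    (hne : S.Nonempty) : 0 < ⨆ x, sliceLength S x := by
  obtain ⟨⟨x, y⟩, hxy⟩ := hne
  refine lt_of_lt_of_le ?_ (le_ciSup (bddAbove_sliceLength hb) x)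
  refine ENNReal.toReal_pos ?_ (volume_slice_ne_top hb x)
  exact (IsOpen.measure_pos _ (hS.preimage (by fun_prop)) ⟨y, hxy⟩).ne'

open scoped Pointwise in
/-- The planar Brunn–Minkowski inequality, for sets in `ℝ × ℝ`. -/
lemma sqrt_volume_add_sqrt_volume_le_prod {A B : Set (ℝ × ℝ)} (hA : IsOpen A) (hB : IsOpen B)
    (hbA : Bornology.IsBounded A) (hbB : Bornology.IsBounded B) (hA' : A.Nonempty)
    (hB' : B.Nonempty) :
    √(volume A).toReal + √(volume B).toReal ≤ √(volume (A + B)).toReal := by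
  set F := ⨆ x, sliceLength A x with hF
  set G := ⨆ x, sliceLength B x with hG
  have hF0 : 0 < F := sliceLength_iSup_pos hA hbA hA'
  have hG0 : 0 < G := sliceLength_iSup_pos hB hbB hB'
  have hS : IsOpen (A + B) := hB.add_left
  have hbS : Bornology.IsBounded (A + B) := hbA.add hbB
  have hadd : ∀ x y, (Prod.mk x ⁻¹' A).Nonempty → (Prod.mk y ⁻¹' B).Nonempty →
      sliceLength A x + sliceLength B y ≤ sliceLength (A + B) (x + y) := by
    intro x y hx hy
    have hAo : IsOpen (Prod.mk x ⁻¹' A) := hA.preimage (by fun_prop)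
    have hBo : IsOpen (Prod.mk y ⁻¹' B) := hB.preimage (by fun_prop)
    unfold sliceLength
    rw [← ENNReal.toReal_add (volume_slice_ne_top hbA x) (volume_slice_ne_top hbB y)]
    refine ENNReal.toReal_mono (volume_slice_ne_top hbS _) ?_
    refine (volume_add_volume_le hAo.measurableSet hBo.measurableSet hx hy).trans
      (measure_mono ?_)
    rintro _ ⟨a, ha, b, hb, rfl⟩
    exact ⟨(x, a), ha, (y, b), hb, rfl⟩
  have hne : ∀ (S : Set (ℝ × ℝ)) (x : ℝ), 0 < sliceLength S x → (Prod.mk x ⁻¹' S).Nonempty := by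
    intro S x h
    by_contra hcon
    rw [not_nonempty_iff_eq_empty] at hcon
    simp [sliceLength, hcon] at h
  have hlevel : ∀ τ ∈ Ioi (0 : ℝ), volume {x | τ < sliceLength A x / F} +
      volume {x | τ < sliceLength B x / G} ≤ volume {x | τ < sliceLength (A + B) x / (F + G)} := by
    intro τ hτ
    have hτ0 : 0 < τ := hτ
    rcases lt_or_ge τ 1 with h1 | h1
    · have nonempty : ∀ S : Set (ℝ × ℝ), 0 < (⨆ x, sliceLength S x) →
          {x | τ < sliceLength S x / ⨆ x, sliceLength S x}.Nonempty := by
        intro S h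
        obtain ⟨x, hx⟩ := exists_lt_of_lt_ciSup (show τ * (⨆ x, sliceLength S x) <
          ⨆ x, sliceLength S x by nlinarith)
        exact ⟨x, by simpa only [mem_ofPred_eq, lt_div_iff₀ h] using hx⟩
      refine (volume_add_volume_le
        (measurableSet_lt measurable_const
          ((measurable_sliceLength hA.measurableSet).div_const F))
        (measurableSet_lt measurable_const
          ((measurable_sliceLength hB.measurableSet).div_const G))
        (nonempty A hF0) (nonempty B hG0)).trans (measure_mono ?_)
      rintro _ ⟨x, hx, y, hy, rfl⟩
      simp only [mem_ofPred_eq, lt_div_iff₀ hF0, lt_div_iff₀ hG0,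
        lt_div_iff₀ (add_pos hF0 hG0)] at hx hy ⊢
      have := hadd x y (hne A x ((mul_pos hτ0 hF0).trans hx))
        (hne B y ((mul_pos hτ0 hG0).trans hy))
      linarith
    · have empty : ∀ S : Set (ℝ × ℝ), Bornology.IsBounded S → 0 < (⨆ x, sliceLength S x) →
          {x | τ < sliceLength S x / ⨆ x, sliceLength S x} = ∅ := by
        intro S hb h
        refine eq_empty_of_forall_notMem fun x hx => ?_
        simp only [mem_ofPred_eq, lt_div_iff₀ h] at hx
        have := le_ciSup (bddAbove_sliceLength hb) x
        nlinarith
      rw [hF, hG, empty A hbA hF0, empty B hbB hG0]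
      simp
  have hmain : volume A / ENNReal.ofReal F + volume B / ENNReal.ofReal G ≤
      volume (A + B) / ENNReal.ofReal (F + G) := by
    rw [← lintegral_volume_lt_sliceLength hA.measurableSet hbA hF0,
      ← lintegral_volume_lt_sliceLength hB.measurableSet hbB hG0,
      ← lintegral_volume_lt_sliceLength hS.measurableSet hbS (add_pos hF0 hG0),
      ← lintegral_add_left']
    · exact setLIntegral_mono' measurableSet_Ioi hlevel
    · refine (Antitone.measurable fun s t hst => measure_mono fun x hx => ?_).aemeasurable
      exact lt_of_le_of_lt hst hx
  have hreal : (volume A).toReal / F + (volume B).toReal / G ≤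
      (volume (A + B)).toReal / (F + G) := by
    have hdiv : ∀ (m : ℝ≥0∞) (c : ℝ), 0 < c → (m / ENNReal.ofReal c).toReal = m.toReal / c := by
      intro m c hc
      rw [ENNReal.toReal_div, ENNReal.toReal_ofReal hc.le]
    have hfin : ∀ (m : ℝ≥0∞) (c : ℝ), 0 < c → m ≠ ∞ → m / ENNReal.ofReal c ≠ ∞ := by
      intro m c hc hm
      exact ENNReal.div_ne_top hm (by simpa using hc)
    rw [← hdiv _ _ hF0, ← hdiv _ _ hG0, ← hdiv _ _ (add_pos hF0 hG0),
      ← ENNReal.toReal_add (hfin _ _ hF0 hbA.measure_lt_top.ne)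
        (hfin _ _ hG0 hbB.measure_lt_top.ne)]
    exact ENNReal.toReal_mono (hfin _ _ (add_pos hF0 hG0) hbS.measure_lt_top.ne) hmain
  refine Real.le_sqrt_of_sq_le ?_
  set a := √(volume A).toReal
  set b := √(volume B).toReal
  have ha : (volume A).toReal = a ^ 2 := (Real.sq_sqrt ENNReal.toReal_nonneg).symm
  have hb : (volume B).toReal = b ^ 2 := (Real.sq_sqrt ENNReal.toReal_nonneg).symm
  rw [ha, hb, le_div_iff₀ (add_pos hF0 hG0)] at hreal
  refine le_trans ?_ hreal
  have : (a ^ 2 / F + b ^ 2 / G) * (F + G) - (a + b) ^ 2 = (a * G - b * F) ^ 2 / (F * G) := by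
    field_simp
    ring
  have h2 : 0 ≤ (a * G - b * F) ^ 2 / (F * G) := by positivity
  linarith

open scoped Pointwise in
/-- The planar Brunn–Minkowski inequality. -/
lemma sqrt_volume_add_sqrt_volume_le {A B : Set E2} (hA : IsOpen A) (hB : IsOpen B)
    (hbA : Bornology.IsBounded A) (hbB : Bornology.IsBounded B) (hA' : A.Nonempty)
    (hB' : B.Nonempty) :
    √(volume A).toReal + √(volume B).toReal ≤ √(volume (A + B)).toReal := by
  let T : (ℝ × ℝ) ≃L[ℝ] E2 := (ContinuousLinearEquiv.finTwoArrow ℝ ℝ).symm.trans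
    (PiLp.continuousLinearEquiv 2 ℝ (fun _ : Fin 2 => ℝ)).symm
  have hT : MeasurePreserving T volume volume :=
    (PiLp.volume_preserving_toLp (Fin 2)).comp
      ((volume_preserving_finTwoArrow ℝ).symm (e := MeasurableEquiv.finTwoArrow))
  have hvol : ∀ S : Set E2, IsOpen S → volume (T ⁻¹' S) = volume S := fun S hS =>
    hT.measure_preimage hS.measurableSet.nullMeasurableSet
  have hbdd : ∀ S : Set E2, Bornology.IsBounded S → Bornology.IsBounded (T ⁻¹' S) := by
    intro S hS
    rw [← T.image_symm_eq_preimage]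
    exact T.symm.lipschitz.isBounded_image hS
  have hpre : T ⁻¹' A + T ⁻¹' B = T ⁻¹' (A + B) := by
    ext x
    constructor
    · rintro ⟨a, ha, b, hb, rfl⟩
      exact ⟨T a, ha, T b, hb, (map_add T a b).symm⟩
    · rintro ⟨a, ha, b, hb, h⟩
      refine ⟨T.symm a, by simpa using ha, T.symm b, by simpa using hb, ?_⟩
      have h' : a + b = T x := h
      simp only [← map_add, h', T.symm_apply_apply]
  rw [← hvol A hA, ← hvol B hB, ← hvol (A + B) hB.add_left, ← hpre]
  exact sqrt_volume_add_sqrt_volume_le_prod (hA.preimage T.continuous) (hB.preimage T.continuous)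
    (hbdd A hbA) (hbdd B hbB) (hA'.preimage T.surjective) (hB'.preimage T.surjective)

/-- The decreasing rearrangement of `w`, as a function of the measure of superlevel sets. -/
def decrRearr (w : E2 → ℝ) (m : ℝ≥0∞) : ℝ := sSup {s | 0 ≤ s ∧ m < volume {x | s < w x}}

lemma decrRearr_nonneg (w : E2 → ℝ) (m : ℝ≥0∞) : 0 ≤ decrRearr w m :=
  Real.sSup_nonneg fun _ hs => hs.1

lemma bddAbove_levels {w : E2 → ℝ} {B : ℝ} (hw : ∀ x, w x ≤ B) (m : ℝ≥0∞) :
    BddAbove {s | 0 ≤ s ∧ m < volume {x | s < w x}} := by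
  refine ⟨B, fun s hs => ?_⟩
  obtain ⟨x, hx⟩ := nonempty_of_measure_ne_zero (ne_of_gt (lt_of_le_of_lt zero_le hs.2))
  exact (le_of_lt hx).trans (hw x)

lemma exists_gt_lt_volume {w : E2 → ℝ} {m : ℝ≥0∞} {s : ℝ} (h : m < volume {x | s < w x}) :
    ∃ s' > s, m < volume {x | s' < w x} := by
  have hU : {x | s < w x} = ⋃ n : ℕ, {x | s + 1 / ((n : ℝ) + 1) < w x} := by
    ext x
    simp only [mem_ofPred_eq, mem_iUnion]
    constructor
    · intro hx
      obtain ⟨n, hn⟩ := exists_nat_one_div_lt (sub_pos.2 hx)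
      exact ⟨n, by linarith⟩
    · rintro ⟨n, hn⟩
      have : 0 < 1 / ((n : ℝ) + 1) := by positivity
      linarith
  have hmono : Monotone fun n : ℕ => {x | s + 1 / ((n : ℝ) + 1) < w x} := by
    intro a b hab x hx
    have h2 : 1 / ((b : ℝ) + 1) ≤ 1 / ((a : ℝ) + 1) := by gcongr
    simp only [mem_ofPred_eq] at hx ⊢
    linarith
  rw [hU, hmono.measure_iUnion] at h
  obtain ⟨n, hn⟩ := lt_iSup_iff.1 h
  have : 0 < 1 / ((n : ℝ) + 1) := by positivity
  exact ⟨_, by linarith, hn⟩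

lemma lt_decrRearr_iff {w : E2 → ℝ} {B : ℝ} (hw : ∀ x, w x ≤ B) {m : ℝ≥0∞} {s : ℝ}
    (hs : 0 ≤ s) : s < decrRearr w m ↔ m < volume {x | s < w x} := by
  constructor
  · intro h
    have hne : {s | 0 ≤ s ∧ m < volume {x | s < w x}}.Nonempty := by
      by_contra hcon
      rw [not_nonempty_iff_eq_empty] at hcon
      rw [decrRearr, hcon, Real.sSup_empty] at h
      linarith
    obtain ⟨t, ht, hst⟩ := exists_lt_of_lt_csSup hne h
    exact ht.2.trans_le (measure_mono fun x hx => hst.trans hx)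
  · intro h
    obtain ⟨s', hs', hm⟩ := exists_gt_lt_volume h
    exact hs'.trans_le (le_csSup (bddAbove_levels hw m) ⟨hs.trans hs'.le, hm⟩)

lemma decrRearr_le {w : E2 → ℝ} {B : ℝ} (hB : 0 ≤ B) (hw : ∀ x, w x ≤ B) (m : ℝ≥0∞) :
    decrRearr w m ≤ B := by
  by_contra! h
  rw [lt_decrRearr_iff hw hB] at h
  obtain ⟨x, hx⟩ := nonempty_of_measure_ne_zero (ne_of_gt (lt_of_le_of_lt zero_le h))
  exact absurd (hw x) (not_le.2 hx)

/-- The area of the disk of radius `‖x‖`. -/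
def diskArea (x : E2) : ℝ≥0∞ := volume (Metric.ball (0 : E2) ‖x‖)

lemma diskArea_lt_iff {x : E2} {m : ℝ≥0∞} (hm : m ≠ ∞) :
    diskArea x < m ↔ x ∈ Metric.ball (0 : E2) √(m.toReal / π) := by
  have h : diskArea x = ENNReal.ofReal (‖x‖ ^ 2 * π) := by
    rw [diskArea, EuclideanSpace.volume_ball_fin_two, ENNReal.ofReal_mul (by positivity),
      ENNReal.ofReal_pow (norm_nonneg x)]
  rw [h, ENNReal.ofReal_lt_iff_lt_toReal (by positivity) hm, mem_ball_zero_iff,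
    Real.lt_sqrt (norm_nonneg x), lt_div_iff₀ Real.pi_pos]

lemma volume_ball_sqrt_div_pi {m : ℝ≥0∞} (hm : m ≠ ∞) :
    volume (Metric.ball (0 : E2) √(m.toReal / π)) = m := by
  rw [EuclideanSpace.volume_ball_fin_two, ← ENNReal.ofReal_pow (Real.sqrt_nonneg _),
    Real.sq_sqrt (by positivity), ← ENNReal.ofReal_mul (by positivity),
    div_mul_cancel₀ _ Real.pi_ne_zero, ENNReal.ofReal_toReal hm]

/-- The symmetric decreasing rearrangement of `w`. -/
def symmRearr (w : E2 → ℝ) (x : E2) : ℝ := decrRearr w (diskArea x)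

lemma symmRearr_nonneg (w : E2 → ℝ) (x : E2) : 0 ≤ symmRearr w x := decrRearr_nonneg _ _

lemma lt_symmRearr_iff {w : E2 → ℝ} {B : ℝ} (hw : ∀ x, w x ≤ B) {x : E2} {s : ℝ}
    (hs : 0 ≤ s) (hfin : volume {x | s < w x} ≠ ∞) :
    s < symmRearr w x ↔ x ∈ Metric.ball (0 : E2) √((volume {x | s < w x}).toReal / π) := by
  rw [symmRearr, lt_decrRearr_iff hw hs, diskArea_lt_iff hfin]

lemma volume_lt_symmRearr {w : E2 → ℝ} {B : ℝ} (hw : ∀ x, w x ≤ B) {s : ℝ}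
    (hs : 0 ≤ s) (hfin : volume {x | s < w x} ≠ ∞) :
    volume {x | s < symmRearr w x} = volume {x | s < w x} := by
  conv_lhs => simp only [lt_symmRearr_iff hw hs hfin]
  exact volume_ball_sqrt_div_pi hfin

lemma lowerSemicontinuous_symmRearr {w : E2 → ℝ} {B : ℝ} (hw : ∀ x, w x ≤ B)
    (hfin : ∀ s, 0 ≤ s → volume {x | s < w x} ≠ ∞) : LowerSemicontinuous (symmRearr w) := by
  rw [lowerSemicontinuous_iff_isOpen_preimage]
  intro s
  rcases lt_or_ge s 0 with h | h
  · convert isOpen_univ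
    exact eq_univ_of_forall fun x => h.trans_le (symmRearr_nonneg w x)
  · have : symmRearr w ⁻¹' Ioi s =
        Metric.ball (0 : E2) √((volume {x | s < w x}).toReal / π) := by
      ext x
      exact lt_symmRearr_iff hw h (hfin s h)
    rw [this]
    exact Metric.isOpen_ball

/-- The supremal convolution of `f` with the paraboloid `-‖·‖² / (2t)`. -/
def supConv (t : ℝ) (f : E2 → ℝ) (x : E2) : ℝ := ⨆ h, (f (x + h) - ‖h‖ ^ 2 / (2 * t))

lemma bddAbove_supConv {f : E2 → ℝ} {B t : ℝ} (ht : 0 < t) (hf : ∀ x, f x ≤ B) (x : E2) :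
    BddAbove (range fun h => f (x + h) - ‖h‖ ^ 2 / (2 * t)) := by
  refine ⟨B, ?_⟩
  rintro _ ⟨h, rfl⟩
  have : 0 ≤ ‖h‖ ^ 2 / (2 * t) := by positivity
  linarith [hf (x + h)]

lemma le_supConv {f : E2 → ℝ} {B t : ℝ} (ht : 0 < t) (hf : ∀ x, f x ≤ B) (x h : E2) :
    f (x + h) - ‖h‖ ^ 2 / (2 * t) ≤ supConv t f x :=
  le_ciSup (bddAbove_supConv ht hf x) h

lemma lt_supConv_iff {f : E2 → ℝ} {B t : ℝ} (ht : 0 < t) (hf : ∀ x, f x ≤ B) {x : E2} {s : ℝ} :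
    s < supConv t f x ↔ ∃ h, s + ‖h‖ ^ 2 / (2 * t) < f (x + h) := by
  rw [supConv, lt_ciSup_iff (bddAbove_supConv ht hf x)]
  simp only [lt_sub_iff_add_lt]

lemma self_le_supConv {f : E2 → ℝ} {B t : ℝ} (ht : 0 < t) (hf : ∀ x, f x ≤ B) (x : E2) :
    f x ≤ supConv t f x := by
  simpa using le_supConv ht hf x 0

lemma lowerSemicontinuous_supConv {f : E2 → ℝ} {B t : ℝ} (ht : 0 < t) (hf : ∀ x, f x ≤ B)
    (hlsc : LowerSemicontinuous f) : LowerSemicontinuous (supConv t f) := by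
  rw [lowerSemicontinuous_iff_isOpen_preimage] at hlsc ⊢
  intro s
  have : supConv t f ⁻¹' Ioi s =
      ⋃ h : E2, (fun x => x + h) ⁻¹' (f ⁻¹' Ioi (s + ‖h‖ ^ 2 / (2 * t))) := by
    ext x
    simp only [mem_preimage, mem_Ioi, mem_iUnion]
    exact lt_supConv_iff ht hf
  rw [this]
  exact isOpen_iUnion fun h => (hlsc _).preimage (by fun_prop)

open scoped Pointwise in
/-- Supremal convolution with a paraboloid does not increase under symmetrization faster than
the original function, at the level of superlevel sets. -/
lemma volume_lt_supConv_symmRearr_le {w : E2 → ℝ} {B t s : ℝ} (ht : 0 < t) (hs : 0 ≤ s)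
    (hcont : Continuous w) (hw : ∀ x, w x ≤ B) (hc : HasCompactSupport w) (hw0 : ∀ x, 0 ≤ w x) :
    volume {x | s < supConv t (symmRearr w) x} ≤ volume {x | s < supConv t w x} := by
  have hbdd : ∀ r, 0 ≤ r → Bornology.IsBounded {x | r < w x} := by
    intro r hr
    refine hc.isCompact.isBounded.subset fun x hx => subset_tsupport _ ?_
    exact (lt_of_le_of_lt hr hx).ne'
  have hB : 0 ≤ B := (hw0 0).trans (hw 0)
  have hwS : ∀ x, symmRearr w x ≤ B := fun x => decrRearr_le hB hw _
  by_cases hfin : volume {x | s < supConv t w x} = ∞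
  · rw [hfin]; exact le_top
  rw [← volume_ball_sqrt_div_pi hfin]
  refine measure_mono fun x hx => ?_
  obtain ⟨h, hh⟩ := (lt_supConv_iff ht hwS).1 hx
  set s' := s + ‖h‖ ^ 2 / (2 * t) with hs'
  have hs'0 : 0 ≤ s' := by positivity
  have hs'fin : volume {x | s' < w x} ≠ ∞ := (hbdd s' hs'0).measure_lt_top.ne
  rw [lt_symmRearr_iff hw hs'0 hs'fin, mem_ball_zero_iff] at hh
  have hopen : IsOpen {x | s' < w x} := isOpen_lt continuous_const hcont
  have hne : {x | s' < w x}.Nonempty := by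
    rw [nonempty_iff_ne_empty]
    intro hcon
    rw [hcon] at hh
    simp at hh
    exact absurd hh (not_lt.2 (norm_nonneg _))
  have hkey : √((volume {x | s' < w x}).toReal / π) + ‖h‖ ≤
      √((volume {x | s < supConv t w x}).toReal / π) := by
    rw [Real.sqrt_div' _ Real.pi_pos.le, Real.sqrt_div' _ Real.pi_pos.le,
      le_div_iff₀ (by positivity),
      add_mul, div_mul_cancel₀ _ (by positivity)]
    rcases eq_or_lt_of_le (norm_nonneg h) with h0 | h0
    · rw [← h0, zero_mul, add_zero]
      refine Real.sqrt_le_sqrt (ENNReal.toReal_mono hfin (measure_mono fun y hy => ?_))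
      have hss : s' = s := by rw [hs', ← h0]; simp
      rw [hss] at hy
      exact lt_of_lt_of_le hy (self_le_supConv ht hw y)
    · have hball : √(volume (Metric.ball (0 : E2) ‖h‖)).toReal = ‖h‖ * √π := by
        rw [EuclideanSpace.volume_ball_fin_two, ENNReal.toReal_mul, ENNReal.toReal_pow,
          ENNReal.toReal_ofReal (norm_nonneg h), ENNReal.toReal_ofReal Real.pi_pos.le,
          Real.sqrt_mul (by positivity), Real.sqrt_sq (norm_nonneg h)]
      rw [← hball]
      refine (sqrt_volume_add_sqrt_volume_le hopen Metric.isOpen_ball (hbdd s' hs'0)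
        Metric.isBounded_ball hne ⟨0, by simpa using h0⟩).trans
        (Real.sqrt_le_sqrt (ENNReal.toReal_mono hfin (measure_mono ?_)))
      rintro _ ⟨a, ha, b, hb, rfl⟩
      refine (lt_supConv_iff ht hw).2 ⟨-b, ?_⟩
      rw [mem_ball_zero_iff] at hb
      have ha' : s' < w a := ha
      have : ‖b‖ ^ 2 / (2 * t) ≤ ‖h‖ ^ 2 / (2 * t) := by gcongr
      simp only [norm_neg, add_neg_cancel_right]
      linarith
  rw [mem_ball_zero_iff]
  have : ‖x‖ ≤ ‖x + h‖ + ‖h‖ := by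
    simpa using norm_sub_le (x + h) h
  linarith

lemma exists_abs_sub_sub_fderiv_le {u : E2 → ℝ} (hu : ContDiff ℝ (⊤ : ℕ∞) u)
    (hc : HasCompactSupport u) :
    ∃ M : ℝ, 0 ≤ M ∧ ∀ x h, |u (x + h) - u x - fderiv ℝ u x h| ≤ M * ‖h‖ ^ 2 := by
  have hD : ContDiff ℝ (⊤ : ℕ∞) (fderiv ℝ u) := hu.fderiv_right (by simp)
  obtain ⟨M, hM⟩ := hD.lipschitzWith_of_hasCompactSupport (hc.fderiv ℝ) (by simp)
  refine ⟨M, M.2, fun x h => ?_⟩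
  have := Convex.norm_image_sub_le_of_norm_fderiv_le' (𝕜 := ℝ) (f := u) (C := M * ‖h‖)
    (s := Metric.closedBall x ‖h‖) (x := x) (y := x + h) (φ := fderiv ℝ u x)
    (fun y _ => (hu.differentiable (by simp)) y)
    (fun y hy => by
      refine (hM.norm_sub_le y x).trans ?_
      gcongr
      simpa [dist_eq_norm] using hy)
    (convex_closedBall _ _) (by simp) (by simp)
  simpa [pow_two, mul_assoc] using this

lemma supConv_abs_le {u : E2 → ℝ} {M t : ℝ} (ht : 0 < t) (htM : 2 * t * M < 1)
    (hM : ∀ x h, |u (x + h) - u x - fderiv ℝ u x h| ≤ M * ‖h‖ ^ 2) (x : E2) :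
    supConv t (fun y => |u y|) x ≤ |u x| + t / (2 * (1 - 2 * t * M)) * ‖fderiv ℝ u x‖ ^ 2 := by
  refine ciSup_le fun h => ?_
  have h1 : |u (x + h)| ≤ |u x| + ‖fderiv ℝ u x‖ * ‖h‖ + M * ‖h‖ ^ 2 := by
    have h2 : |fderiv ℝ u x h| ≤ ‖fderiv ℝ u x‖ * ‖h‖ := (fderiv ℝ u x).le_opNorm h
    calc |u (x + h)| = |u x + fderiv ℝ u x h + (u (x + h) - u x - fderiv ℝ u x h)| := by
          congr 1; ring
      _ ≤ |u x| + |fderiv ℝ u x h| + |u (x + h) - u x - fderiv ℝ u x h| := abs_add_three _ _ _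
      _ ≤ _ := by gcongr; exact hM x h
  set d := ‖fderiv ℝ u x‖
  set r := ‖h‖
  have hpos : 0 < 1 - 2 * t * M := by linarith
  have h3 : t / (2 * (1 - 2 * t * M)) * d ^ 2 - (d * r + M * r ^ 2 - r ^ 2 / (2 * t)) =
      (t * d - (1 - 2 * t * M) * r) ^ 2 / (2 * t * (1 - 2 * t * M)) := by
    obtain ⟨c, hc⟩ : ∃ c, c = 1 - 2 * t * M := ⟨_, rfl⟩
    have hMc : M = (1 - c) / (2 * t) := by
      rw [hc]
      field_simp
      ring
    rw [← hc] at hpos ⊢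
    rw [hMc]
    field_simp
    ring
  have h4 : 0 ≤ (t * d - (1 - 2 * t * M) * r) ^ 2 / (2 * t * (1 - 2 * t * M)) := by positivity
  linarith

lemma exists_le_apply_add_sub {v : E2 → ℝ} {M t : ℝ} (ht : 0 < t)
    (hM : ∀ x h, |v (x + h) - v x - fderiv ℝ v x h| ≤ M * ‖h‖ ^ 2) (x : E2) :
    ∃ h, v x + t * (1 / 2 - M * t) * ‖fderiv ℝ v x‖ ^ 2 ≤ v (x + h) - ‖h‖ ^ 2 / (2 * t) := by
  set g := (InnerProductSpace.toDual ℝ E2).symm (fderiv ℝ v x) with hg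
  have hgn : ‖g‖ = ‖fderiv ℝ v x‖ := LinearIsometryEquiv.norm_map _ _
  have hgi : fderiv ℝ v x g = ‖g‖ ^ 2 := by
    rw [← real_inner_self_eq_norm_sq, hg, InnerProductSpace.toDual_symm_apply]
  refine ⟨t • g, ?_⟩
  have h1 := neg_le_of_abs_le (hM x (t • g))
  rw [map_smul, hgi, norm_smul, Real.norm_of_nonneg ht.le, smul_eq_mul] at h1
  rw [norm_smul, Real.norm_of_nonneg ht.le, ← hgn]
  have h2 : (t * ‖g‖) ^ 2 / (2 * t) = t * ‖g‖ ^ 2 / 2 := by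
    field_simp
  rw [h2]
  nlinarith

/-- The mollification of `f` by the normalized bump function `φ`. -/
def mollify (φ : ContDiffBump (0 : E2)) (f : E2 → ℝ) : E2 → ℝ :=
  convolution (φ.normed volume) f (ContinuousLinearMap.lsmul ℝ ℝ) volume

lemma mollify_sub_le {φ : ContDiffBump (0 : E2)} {f : E2 → ℝ} {B t : ℝ} (ht : 0 < t)
    (hf : ∀ x, f x ≤ B) (hfi : LocallyIntegrable f) (hS : LocallyIntegrable (supConv t f))
    (x h : E2) :
    mollify φ f (x + h) - ‖h‖ ^ 2 / (2 * t) ≤ mollify φ (supConv t f) x := by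
  have hex : ∀ (g : E2 → ℝ), LocallyIntegrable g → ∀ y,
      Integrable fun z => φ.normed volume z * g (y - z) := fun g hg y =>
    φ.hasCompactSupport_normed.convolutionExists_left (ContinuousLinearMap.lsmul ℝ ℝ)
      φ.continuous_normed hg y
  have h1 : ‖h‖ ^ 2 / (2 * t) = ∫ z, φ.normed volume z * (‖h‖ ^ 2 / (2 * t)) := by
    rw [integral_mul_const, φ.integral_normed, one_mul]
  have h2 : Integrable fun z => φ.normed volume z * (‖h‖ ^ 2 / (2 * t)) :=
    φ.integrable_normed.mul_const _
  rw [h1]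
  simp only [mollify, convolution_def, ContinuousLinearMap.lsmul_apply, smul_eq_mul]
  rw [← integral_sub (hex f hfi _) h2]
  refine integral_mono ((hex f hfi _).sub h2) (hex _ hS _) fun z => ?_
  simp only [← mul_sub]
  refine mul_le_mul_of_nonneg_left ?_ (φ.nonneg_normed z)
  have := le_supConv ht hf (x - z) h
  rwa [sub_add_eq_add_sub] at this

lemma symmRearr_eq_zero {w : E2 → ℝ} {B : ℝ} (hw : ∀ x, w x ≤ B)
    (hfin : volume {x | 0 < w x} ≠ ∞) {x : E2}
    (hx : x ∉ Metric.ball (0 : E2) √((volume {x | 0 < w x}).toReal / π)) : symmRearr w x = 0 :=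
  le_antisymm (not_lt.1 fun h => hx ((lt_symmRearr_iff hw le_rfl hfin).1 h))
    (symmRearr_nonneg w x)

lemma lintegral_symmRearr {w : E2 → ℝ} {B : ℝ} (hw : ∀ x, w x ≤ B) (hw0 : ∀ x, 0 ≤ w x)
    (hm : Measurable w) (hfin : ∀ s, 0 ≤ s → volume {x | s < w x} ≠ ∞) :
    ∫⁻ x, ENNReal.ofReal (symmRearr w x) = ∫⁻ x, ENNReal.ofReal (w x) := by
  rw [lintegral_eq_lintegral_meas_lt _ (Eventually.of_forall (symmRearr_nonneg w))
    (lowerSemicontinuous_symmRearr hw hfin).measurable.aemeasurable,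
    lintegral_eq_lintegral_meas_lt _ (Eventually.of_forall hw0) hm.aemeasurable]
  exact setLIntegral_congr_fun measurableSet_Ioi fun s (hs : 0 < s) =>
    volume_lt_symmRearr hw hs.le (hfin s hs.le)

lemma lintegral_symmRearr_rpow {w : E2 → ℝ} {B : ℝ} (hw : ∀ x, w x ≤ B) (hw0 : ∀ x, 0 ≤ w x)
    (hm : Measurable w) (hfin : ∀ s, 0 ≤ s → volume {x | s < w x} ≠ ∞) {p : ℝ} (hp : 0 < p) :
    ∫⁻ x, ENNReal.ofReal (symmRearr w x ^ p) = ∫⁻ x, ENNReal.ofReal (w x ^ p) := by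
  rw [lintegral_rpow_eq_lintegral_meas_lt_mul _ (Eventually.of_forall (symmRearr_nonneg w))
    (lowerSemicontinuous_symmRearr hw hfin).measurable.aemeasurable hp,
    lintegral_rpow_eq_lintegral_meas_lt_mul _ (Eventually.of_forall hw0) hm.aemeasurable hp]
  congr 1
  exact setLIntegral_congr_fun measurableSet_Ioi fun s (hs : 0 < s) => by
    rw [volume_lt_symmRearr hw hs.le (hfin s hs.le)]

lemma integrable_sq_norm_fderiv {u : E2 → ℝ} (hu : ContDiff ℝ (⊤ : ℕ∞) u)
    (hc : HasCompactSupport u) : Integrable fun x => ‖fderiv ℝ u x‖ ^ 2 := by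
  have : Continuous (fderiv ℝ u) := hu.continuous_fderiv (by simp)
  have hcont : Continuous fun x => ‖fderiv ℝ u x‖ ^ 2 := this.norm.pow 2
  refine hcont.integrable_of_hasCompactSupport ?_
  exact (hc.fderiv ℝ).comp_left (g := fun L : E2 →L[ℝ] ℝ => ‖L‖ ^ 2) (by simp)

lemma volume_lt_abs_ne_top {u : E2 → ℝ} (hc : HasCompactSupport u) {s : ℝ} (hs : 0 ≤ s) :
    volume {x | s < |u x|} ≠ ∞ := by
  refine ne_top_of_le_ne_top hc.isCompact.measure_lt_top.ne (measure_mono fun x hx => ?_)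
  exact subset_tsupport _ (abs_pos.1 (lt_of_le_of_lt hs hx))

lemma exists_abs_le {u : E2 → ℝ} (hu : Continuous u) (hc : HasCompactSupport u) :
    ∃ B, ∀ x, |u x| ≤ B :=
  hc.exists_bound_of_continuous hu

lemma hasCompactSupport_symmRearr {u : E2 → ℝ} (hu : Continuous u) (hc : HasCompactSupport u) :
    HasCompactSupport (symmRearr fun x => |u x|) := by
  obtain ⟨B, hB⟩ := exists_abs_le hu hc
  refine HasCompactSupport.intro (isCompact_closedBall (0 : E2) _) fun x hx =>
    symmRearr_eq_zero hB (volume_lt_abs_ne_top hc le_rfl)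
      fun h => hx (Metric.ball_subset_closedBall h)

lemma integrable_symmRearr {u : E2 → ℝ} (hu : Continuous u) (hc : HasCompactSupport u) :
    Integrable (symmRearr fun x => |u x|) := by
  obtain ⟨B, hB⟩ := exists_abs_le hu hc
  have hfin : ∀ s, 0 ≤ s → volume {x | s < |u x|} ≠ ∞ := fun s => volume_lt_abs_ne_top hc
  refine (lintegral_ofReal_ne_top_iff_integrable
    (lowerSemicontinuous_symmRearr hB hfin).measurable.aestronglyMeasurable
    (Eventually.of_forall (symmRearr_nonneg _))).1 ?_
  rw [lintegral_symmRearr hB (fun x => abs_nonneg _) hu.abs.measurable hfin]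
  exact (hu.abs.integrable_of_hasCompactSupport hc.abs).lintegral_lt_top.ne

lemma integral_symmRearr {u : E2 → ℝ} (hu : Continuous u) (hc : HasCompactSupport u) :
    ∫ x, symmRearr (fun x => |u x|) x = ∫ x, |u x| := by
  obtain ⟨B, hB⟩ := exists_abs_le hu hc
  have hfin : ∀ s, 0 ≤ s → volume {x | s < |u x|} ≠ ∞ := fun s => volume_lt_abs_ne_top hc
  rw [integral_eq_lintegral_of_nonneg_ae (Eventually.of_forall (symmRearr_nonneg _))
    (lowerSemicontinuous_symmRearr hB hfin).measurable.aestronglyMeasurable,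
    lintegral_symmRearr hB (fun x => abs_nonneg _) hu.abs.measurable hfin,
    integral_eq_lintegral_of_nonneg_ae (Eventually.of_forall fun x => abs_nonneg _)
    hu.abs.aestronglyMeasurable]

lemma integrable_supConv_symmRearr {u : E2 → ℝ} {M t : ℝ} (hu : ContDiff ℝ (⊤ : ℕ∞) u)
    (hc : HasCompactSupport u) (ht : 0 < t) (htM : 2 * t * M < 1)
    (hM : ∀ x h, |u (x + h) - u x - fderiv ℝ u x h| ≤ M * ‖h‖ ^ 2) :
    Integrable (supConv t (symmRearr fun x => |u x|)) ∧
    ∫ x, supConv t (symmRearr fun x => |u x|) x ≤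
      (∫ x, |u x|) + t / (2 * (1 - 2 * t * M)) * ∫ x, ‖fderiv ℝ u x‖ ^ 2 := by
  obtain ⟨B, hB⟩ := exists_abs_le hu.continuous hc
  have hB0 : 0 ≤ B := (abs_nonneg _).trans (hB 0)
  have hfin : ∀ s, 0 ≤ s → volume {x | s < |u x|} ≠ ∞ := fun s => volume_lt_abs_ne_top hc
  have hSB : ∀ x, symmRearr (fun x => |u x|) x ≤ B := fun x => decrRearr_le hB0 hB _
  have hlsc := lowerSemicontinuous_supConv ht hSB (lowerSemicontinuous_symmRearr hB hfin)
  have hlsc' := lowerSemicontinuous_supConv ht hB hu.continuous.abs.lowerSemicontinuous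
  have hS0 : ∀ x, 0 ≤ supConv t (symmRearr fun x => |u x|) x := fun x =>
    (symmRearr_nonneg _ x).trans (self_le_supConv ht hSB x)
  have hT0 : ∀ x, 0 ≤ supConv t (fun x => |u x|) x := fun x =>
    (abs_nonneg (u x)).trans (self_le_supConv ht hB x)
  have hi1 : Integrable fun x => |u x| :=
    hu.continuous.abs.integrable_of_hasCompactSupport hc.abs
  have hi2 := (integrable_sq_norm_fderiv hu hc).const_mul (t / (2 * (1 - 2 * t * M)))
  have hpos : 0 < 1 - 2 * t * M := by linarith
  have hle : ∫⁻ x, ENNReal.ofReal (supConv t (symmRearr fun x => |u x|) x) ≤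
      ENNReal.ofReal ((∫ x, |u x|) + t / (2 * (1 - 2 * t * M)) * ∫ x, ‖fderiv ℝ u x‖ ^ 2) := by
    calc ∫⁻ x, ENNReal.ofReal (supConv t (symmRearr fun x => |u x|) x)
        ≤ ∫⁻ x, ENNReal.ofReal (supConv t (fun x => |u x|) x) := by
          rw [lintegral_eq_lintegral_meas_lt _ (Eventually.of_forall hS0)
              hlsc.measurable.aemeasurable,
            lintegral_eq_lintegral_meas_lt _ (Eventually.of_forall hT0)
              hlsc'.measurable.aemeasurable]
          exact setLIntegral_mono' measurableSet_Ioi fun s (hs : 0 < s) =>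
            volume_lt_supConv_symmRearr_le ht hs.le hu.continuous.abs hB hc.abs
              fun x => abs_nonneg _
      _ ≤ ∫⁻ x, ENNReal.ofReal (|u x| + t / (2 * (1 - 2 * t * M)) * ‖fderiv ℝ u x‖ ^ 2) :=
          lintegral_mono fun x => ENNReal.ofReal_le_ofReal (supConv_abs_le ht htM hM x)
      _ = _ := by
          rw [← integral_const_mul, ← integral_add hi1 hi2,
            ofReal_integral_eq_lintegral_ofReal (f := fun x => |u x| +
              t / (2 * (1 - 2 * t * M)) * ‖fderiv ℝ u x‖ ^ 2) (hi1.add hi2)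
              (Eventually.of_forall fun x => by positivity)]
  have hint : Integrable (supConv t (symmRearr fun x => |u x|)) :=
    (lintegral_ofReal_ne_top_iff_integrable hlsc.measurable.aestronglyMeasurable
      (Eventually.of_forall hS0)).1 (ne_top_of_le_ne_top ENNReal.ofReal_ne_top hle)
  refine ⟨hint, ?_⟩
  rw [← ofReal_integral_eq_lintegral_ofReal hint (Eventually.of_forall hS0)] at hle
  refine (ENNReal.ofReal_le_ofReal_iff ?_).1 hle
  have h1 : 0 ≤ ∫ x, |u x| := integral_nonneg fun x => abs_nonneg _
  have h2 : 0 ≤ ∫ x, ‖fderiv ℝ u x‖ ^ 2 := integral_nonneg fun x => by positivity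
  positivity

lemma contDiff_mollify (φ : ContDiffBump (0 : E2)) {f : E2 → ℝ} (hf : LocallyIntegrable f) :
    ContDiff ℝ (⊤ : ℕ∞) (mollify φ f) :=
  φ.hasCompactSupport_normed.contDiff_convolution_left _ φ.contDiff_normed hf

lemma hasCompactSupport_mollify (φ : ContDiffBump (0 : E2)) {f : E2 → ℝ}
    (hf : HasCompactSupport f) : HasCompactSupport (mollify φ f) :=
  φ.hasCompactSupport_normed.convolution _ hf

/-- The Pólya–Szegő inequality for mollifications of the symmetric decreasing rearrangement. -/
lemma integral_sq_fderiv_mollify_symmRearr_le {u : E2 → ℝ} (hu : ContDiff ℝ (⊤ : ℕ∞) u)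
    (hc : HasCompactSupport u) (φ : ContDiffBump (0 : E2)) :
    ∫ x, ‖fderiv ℝ (mollify φ (symmRearr fun x => |u x|)) x‖ ^ 2 ≤ ∫ x, ‖fderiv ℝ u x‖ ^ 2 := by
  set f := symmRearr fun x => |u x| with hf
  set v := mollify φ f with hv
  obtain ⟨B, hB⟩ := exists_abs_le hu.continuous hc
  have hB0 : 0 ≤ B := (abs_nonneg _).trans (hB 0)
  have hSB : ∀ x, f x ≤ B := fun x => decrRearr_le hB0 hB _
  have hfi : Integrable f := integrable_symmRearr hu.continuous hc
  have hvs : ContDiff ℝ (⊤ : ℕ∞) v := contDiff_mollify φ hfi.locallyIntegrable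
  have hvc : HasCompactSupport v :=
    hasCompactSupport_mollify φ (hasCompactSupport_symmRearr hu.continuous hc)
  obtain ⟨M, hM0, hM⟩ := exists_abs_sub_sub_fderiv_le hu hc
  obtain ⟨M', hM'0, hM'⟩ := exists_abs_sub_sub_fderiv_le hvs hvc
  have hmass : ∀ g : E2 → ℝ, Integrable g → ∫ x, mollify φ g x = ∫ x, g x := by
    intro g hg
    rw [mollify, integral_convolution _ φ.integrable_normed hg, φ.integral_normed]
    simp
  set P := ∫ x, ‖fderiv ℝ v x‖ ^ 2
  set Q := ∫ x, ‖fderiv ℝ u x‖ ^ 2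
  have key : ∀ t : ℝ, 0 < t → 2 * t * M < 1 →
      (1 - 2 * M' * t) * (1 - 2 * t * M) * P ≤ Q := by
    intro t ht htM
    obtain ⟨hSi, hSle⟩ := integrable_supConv_symmRearr hu hc ht htM hM
    have hpt : ∀ x, v x + t * (1 / 2 - M' * t) * ‖fderiv ℝ v x‖ ^ 2 ≤
        mollify φ (supConv t f) x := by
      intro x
      obtain ⟨h, hh⟩ := exists_le_apply_add_sub ht hM' x
      exact hh.trans (mollify_sub_le ht hSB hfi.locallyIntegrable hSi.locallyIntegrable x h)
    have hi1 : Integrable v := hvs.continuous.integrable_of_hasCompactSupport hvc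
    have hi2 := (integrable_sq_norm_fderiv hvs hvc).const_mul (t * (1 / 2 - M' * t))
    have hi3 : Integrable (mollify φ (supConv t f)) :=
      φ.integrable_normed.integrable_convolution _ hSi
    have h1 := integral_mono (hi1.add hi2) hi3 hpt
    simp only [Pi.add_apply] at h1
    rw [integral_add hi1 hi2, integral_const_mul, hmass _ hSi, hmass _ hfi, hf,
      integral_symmRearr hu.continuous hc] at h1
    have h2 : t * (1 / 2 - M' * t) * P ≤ t / (2 * (1 - 2 * t * M)) * Q := by
      linarith
    have hpos : 0 < 1 - 2 * t * M := by linarith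
    rw [div_mul_eq_mul_div, le_div_iff₀ (by positivity)] at h2
    refine le_of_mul_le_mul_left ?_ ht
    linarith
  have hlim : Tendsto (fun t : ℝ => (1 - 2 * M' * t) * (1 - 2 * t * M) * P) (nhdsWithin 0 (Ioi 0))
      (nhds ((1 - 2 * M' * 0) * (1 - 2 * 0 * M) * P)) :=
    (Continuous.tendsto (by fun_prop) 0).mono_left nhdsWithin_le_nhds
  have hev : ∀ᶠ t : ℝ in nhdsWithin 0 (Ioi 0), 2 * t * M < 1 := by
    have : Tendsto (fun t : ℝ => 2 * t * M) (nhds 0) (nhds (2 * 0 * M)) :=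
      Continuous.tendsto (by fun_prop) 0
    exact nhdsWithin_le_nhds (this.eventually_lt_const (by simp))
  have := le_of_tendsto hlim (by
    filter_upwards [hev, self_mem_nhdsWithin] with t h1 h2
    exact key t h2 h1)
  simpa using this

lemma IsTestFun.hasCompactSupport {Ω : Set E2} {u : E2 → ℝ} (hu : IsTestFun Ω u) :
    HasCompactSupport u := hu.2.1

lemma IsTestFun.setIntegral_abs_rpow {Ω : Set E2} {u : E2 → ℝ} (hu : IsTestFun Ω u) {p : ℝ}
    (hp : 0 < p) : ∫ x in Ω, |u x| ^ p = ∫ x, |u x| ^ p := by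
  refine setIntegral_eq_integral_of_forall_compl_eq_zero fun x hx => ?_
  rw [image_eq_zero_of_notMem_tsupport fun h => hx (hu.2.2 h), abs_zero, Real.zero_rpow hp.ne']

lemma IsTestFun.setIntegral_sq_fderiv {Ω : Set E2} {u : E2 → ℝ} (hu : IsTestFun Ω u) :
    ∫ x in Ω, ‖fderiv ℝ u x‖ ^ 2 = ∫ x, ‖fderiv ℝ u x‖ ^ 2 := by
  refine setIntegral_eq_integral_of_forall_compl_eq_zero fun x hx => ?_
  have : fderiv ℝ u x = 0 := by
    by_contra h
    exact hx (hu.2.2 (support_fderiv_subset ℝ h))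
  simp [this]

lemma lambdaP_mul_le {Ω : Set E2} {v : E2 → ℝ} {p : ℝ} (hp : 0 < p)
    (hv : IsTestFun (symDisk Ω) v) :
    lambdaP Ω p * (∫ x in symDisk Ω, |v x| ^ p) ^ (2 / p) ≤
      ∫ x in symDisk Ω, ‖fderiv ℝ v x‖ ^ 2 := by
  set I := ∫ x in symDisk Ω, |v x| ^ p with hI
  have hI0 : 0 ≤ I := integral_nonneg fun x => by positivity
  have hD0 : 0 ≤ ∫ x in symDisk Ω, ‖fderiv ℝ v x‖ ^ 2 := integral_nonneg fun x => by positivity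
  rcases hI0.eq_or_lt with h | hpos
  · rw [← h, Real.zero_rpow (by positivity), mul_zero]
    exact hD0
  set c := I ^ (-(1 / p)) with hc
  have hc0 : 0 < c := Real.rpow_pos_of_pos hpos _
  have hmem : c ^ 2 * ∫ x in symDisk Ω, ‖fderiv ℝ v x‖ ^ 2 ∈ {c : ℝ | ∃ u : E2 → ℝ,
      IsTestFun (symDisk Ω) u ∧ (∫ x in symDisk Ω, |u x| ^ p) ^ (1 / p) = 1 ∧
      c = ∫ x in symDisk Ω, ‖fderiv ℝ u x‖ ^ 2} := by
    have hsub : tsupport (fun x => c * v x) ⊆ tsupport v := tsupport_mul_subset_right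
    refine ⟨fun x => c * v x, ⟨contDiff_const.mul hv.1, ?_, hsub.trans hv.2.2⟩, ?_, ?_⟩
    · exact hv.2.1.of_isClosed_subset (isClosed_tsupport _) hsub
    · simp only [abs_mul, abs_of_pos hc0, Real.mul_rpow hc0.le (abs_nonneg _)]
      rw [integral_const_mul, ← hI, hc, ← Real.rpow_mul hI0]
      have : -(1 / p) * p = -1 := by field_simp
      rw [this, Real.rpow_neg_one, inv_mul_cancel₀ hpos.ne', Real.one_rpow]
    · have hfd : ∀ x, fderiv ℝ (fun x => c * v x) x = c • fderiv ℝ v x := fun x =>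
        fderiv_const_mul (hv.1.differentiable (by simp) x) c
      simp only [hfd, norm_smul, Real.norm_of_nonneg hc0.le, mul_pow]
      rw [integral_const_mul]
  have hle : lambdaP Ω p ≤ c ^ 2 * ∫ x in symDisk Ω, ‖fderiv ℝ v x‖ ^ 2 := by
    refine csInf_le ⟨0, ?_⟩ hmem
    rintro _ ⟨u, -, -, rfl⟩
    exact integral_nonneg fun x => by positivity
  have hcI : c ^ 2 * I ^ (2 / p) = 1 := by
    rw [hc, ← Real.rpow_natCast, ← Real.rpow_mul hI0, ← Real.rpow_add hpos]
    have : -(1 / p) * ((2 : ℕ) : ℝ) + 2 / p = 0 := by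
      push_cast
      ring
    rw [this, Real.rpow_zero]
  calc lambdaP Ω p * I ^ (2 / p)
      ≤ c ^ 2 * (∫ x in symDisk Ω, ‖fderiv ℝ v x‖ ^ 2) * I ^ (2 / p) := by gcongr
    _ = (c ^ 2 * I ^ (2 / p)) * ∫ x in symDisk Ω, ‖fderiv ℝ v x‖ ^ 2 := by ring
    _ = _ := by rw [hcI, one_mul]

lemma volume_lt_volume_of_isCompact_subset {K Ω : Set E2} (hK : IsCompact K) (hΩ : IsOpen Ω)
    (hne : Ω.Nonempty) (hb : Bornology.IsBounded Ω) (h : K ⊆ Ω) : volume K < volume Ω := by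
  have hdne : (Ω \ K).Nonempty := by
    by_contra hcon
    rw [not_nonempty_iff_eq_empty, sdiff_eq_empty] at hcon
    have heq : Ω = K := hcon.antisymm h
    have hclopen : IsClopen Ω := ⟨heq ▸ hK.isClosed, hΩ⟩
    have huniv : Ω = univ := hclopen.eq_univ hne
    rw [huniv] at hb
    exact NormedSpace.unbounded_univ ℝ E2 hb
  have hpos : 0 < volume (Ω \ K) := (hΩ.sdiff hK.isClosed).measure_pos _ hdne
  have hfin : volume K ≠ ∞ := hK.measure_lt_top.ne
  have hdiff := measure_sdiff h hK.isClosed.measurableSet.nullMeasurableSet hfin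
  rw [hdiff] at hpos
  exact tsub_pos_iff_lt.1 hpos

lemma tsupport_mollify_subset {φ : ContDiffBump (0 : E2)} {f : E2 → ℝ} {r : ℝ}
    (hf : Function.support f ⊆ Metric.ball 0 r) :
    tsupport (mollify φ f) ⊆ Metric.closedBall 0 (φ.rOut + r) := by
  refine closure_minimal ?_ Metric.isClosed_closedBall
  refine (support_convolution_subset (ContinuousLinearMap.lsmul ℝ ℝ)).trans ?_
  rw [φ.support_normed_eq]
  rintro _ ⟨a, ha, b, hb, rfl⟩
  have hb' := hf hb
  rw [mem_ball_zero_iff] at ha hb'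
  rw [mem_closedBall_zero_iff]
  exact (norm_add_le a b).trans (by linarith)

/-- The Faber–Krahn inequality: among sets of given area, the disk minimizes `λ_p`. -/
lemma lambdaP_mul_setIntegral_rpow_le {Ω : Set E2} {u : E2 → ℝ} {p : ℝ} (hne : Ω.Nonempty)
    (hO : IsOpen Ω) (hb : Bornology.IsBounded Ω) (hp : 0 < p) (hpos : 0 < lambdaP Ω p)
    (hu : IsTestFun Ω u) :
    lambdaP Ω p * (∫ x in Ω, |u x| ^ p) ^ (2 / p) ≤ ∫ x in Ω, ‖fderiv ℝ u x‖ ^ 2 := by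
  rw [hu.setIntegral_abs_rpow hp, hu.setIntegral_sq_fderiv]
  have hc : HasCompactSupport u := hu.2.1
  have hcont : Continuous u := hu.1.continuous
  set G := ∫ x, ‖fderiv ℝ u x‖ ^ 2 with hG
  have hG0 : 0 ≤ G := integral_nonneg fun x => by positivity
  set f := symmRearr fun x => |u x| with hf
  obtain ⟨B, hB⟩ := exists_abs_le hcont hc
  have hfin : ∀ s, 0 ≤ s → volume {x | s < |u x|} ≠ ∞ := fun s => volume_lt_abs_ne_top hc
  have hfi : LocallyIntegrable f := (integrable_symmRearr hcont hc).locallyIntegrable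
  set r := √((volume {x | 0 < |u x|}).toReal / π) with hr
  set R := √((volume Ω).toReal / π) with hR
  have hrR : r < R := by
    have hvol : volume {x | 0 < |u x|} < volume Ω :=
      lt_of_le_of_lt (measure_mono fun x hx => subset_tsupport _ (abs_pos.1 hx))
        (volume_lt_volume_of_isCompact_subset hu.2.1 hO hne hb hu.2.2)
    refine Real.sqrt_lt_sqrt (by positivity) ?_
    have := (ENNReal.toReal_lt_toReal hvol.ne_top hb.measure_lt_top.ne).2 hvol
    gcongr
  have hsupp : Function.support f ⊆ Metric.ball 0 r := by
    intro x hx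
    by_contra hcon
    exact hx (symmRearr_eq_zero hB (hfin 0 le_rfl) hcon)
  set δ := (R - r) / 2 with hδ
  have hδ0 : 0 < δ := by linarith
  let φ : ℕ → ContDiffBump (0 : E2) := fun n =>
    { rIn := δ / 2 * (1 / ((n : ℝ) + 1))
      rOut := δ * (1 / ((n : ℝ) + 1))
      rIn_pos := by positivity
      rIn_lt_rOut := by
        have : 0 < 1 / ((n : ℝ) + 1) := by positivity
        nlinarith }
  have hφout : ∀ n, (φ n).rOut ≤ δ := by
    intro n
    have : 1 / ((n : ℝ) + 1) ≤ 1 := by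
      rw [div_le_one (by positivity)]
      linarith [n.cast_nonneg (α := ℝ)]
    calc (φ n).rOut = δ * (1 / ((n : ℝ) + 1)) := rfl
      _ ≤ δ := by nlinarith
  have hφlim : Tendsto (fun n => (φ n).rOut) atTop (nhds 0) := by
    have := (tendsto_one_div_add_atTop_nhds_zero_nat (𝕜 := ℝ)).const_mul δ
    rwa [mul_zero] at this
  have hae := ContDiffBump.ae_convolution_tendsto_right_of_locallyIntegrable (μ := volume)
    (K := 2) hφlim (Eventually.of_forall fun n => by
      change δ * (1 / ((n : ℝ) + 1)) ≤ 2 * (δ / 2 * (1 / ((n : ℝ) + 1)))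
      linarith) hfi
  have htest : ∀ n, IsTestFun (symDisk Ω) (mollify (φ n) f) := by
    intro n
    refine ⟨contDiff_mollify _ hfi,
      hasCompactSupport_mollify _ (hasCompactSupport_symmRearr hcont hc),
      (tsupport_mollify_subset hsupp).trans (Metric.closedBall_subset_ball ?_)⟩
    have := hφout n
    rw [← hR]
    linarith
  set K := (G / lambdaP Ω p) ^ (p / 2) with hK
  have hroot : ∀ I : ℝ, 0 ≤ I → (I ^ (2 / p)) ^ (p / 2) = I := by
    intro I hI
    rw [← Real.rpow_mul hI, div_mul_div_cancel₀' (by positivity), div_self (by positivity),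
      Real.rpow_one]
  have hbound : ∀ n, ∫⁻ x, ENNReal.ofReal (|mollify (φ n) f x| ^ p) ≤ ENNReal.ofReal K := by
    intro n
    have h1 := lambdaP_mul_le hp (htest n)
    rw [(htest n).setIntegral_abs_rpow hp, (htest n).setIntegral_sq_fderiv] at h1
    have h2 := h1.trans (integral_sq_fderiv_mollify_symmRearr_le hu.1 hc (φ n))
    have hvc := (htest n).1.continuous
    have hint : Integrable fun x => |mollify (φ n) f x| ^ p := by
      have hcp : Continuous fun x => |mollify (φ n) f x| ^ p :=
        hvc.abs.rpow_const fun x => Or.inr hp.le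
      exact hcp.integrable_of_hasCompactSupport
        ((htest n).hasCompactSupport.comp_left (g := fun y : ℝ => |y| ^ p)
          (by simp [Real.zero_rpow hp.ne']))
    rw [← ofReal_integral_eq_lintegral_ofReal hint (Eventually.of_forall fun x => by positivity)]
    refine ENNReal.ofReal_le_ofReal ?_
    have hI0 : 0 ≤ ∫ x, |mollify (φ n) f x| ^ p := integral_nonneg fun x => by positivity
    rw [← hroot _ hI0]
    refine Real.rpow_le_rpow (by positivity) ?_ (by positivity)
    rw [le_div_iff₀ hpos, mul_comm]
    exact h2
  have hfatou : ∫⁻ x, ENNReal.ofReal (f x ^ p) ≤ ENNReal.ofReal K := by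
    calc ∫⁻ x, ENNReal.ofReal (f x ^ p)
        = ∫⁻ x, liminf (fun n => ENNReal.ofReal (|mollify (φ n) f x| ^ p)) atTop := by
          refine lintegral_congr_ae ?_
          filter_upwards [hae] with x hx
          have h1 : Tendsto (fun n => ENNReal.ofReal (|mollify (φ n) f x| ^ p)) atTop
              (nhds (ENNReal.ofReal (|f x| ^ p))) :=
            (ENNReal.continuous_ofReal.tendsto _).comp
              ((Real.continuousAt_rpow_const _ _ (Or.inr hp.le)).tendsto.comp hx.abs)
          rw [h1.liminf_eq, abs_of_nonneg (symmRearr_nonneg _ x)]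
      _ ≤ liminf (fun n => ∫⁻ x, ENNReal.ofReal (|mollify (φ n) f x| ^ p)) atTop := by
          refine lintegral_liminf_le fun n => ?_
          exact ((htest n).1.continuous.abs.rpow_const
            fun x => Or.inr hp.le).measurable.ennreal_ofReal
      _ ≤ ENNReal.ofReal K := by
          refine liminf_le_of_le (by isBoundedDefault) fun b hb => ?_
          obtain ⟨n, hn⟩ := hb.exists
          exact hn.trans (hbound n)
  rw [lintegral_symmRearr_rpow hB (fun x => abs_nonneg _) hcont.abs.measurable hfin hp] at hfatou
  have hI0 : 0 ≤ ∫ x, |u x| ^ p := integral_nonneg fun x => by positivity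
  have hIK : ∫ x, |u x| ^ p ≤ K := by
    rw [integral_eq_lintegral_of_nonneg_ae (Eventually.of_forall fun x => by positivity)
      (hcont.abs.rpow_const fun x => Or.inr hp.le).aestronglyMeasurable]
    exact ENNReal.toReal_le_of_le_ofReal (by positivity) hfatou
  have h3 : (∫ x, |u x| ^ p) ^ (2 / p) ≤ G / lambdaP Ω p := by
    calc (∫ x, |u x| ^ p) ^ (2 / p) ≤ K ^ (2 / p) := Real.rpow_le_rpow hI0 hIK (by positivity)
      _ = G / lambdaP Ω p := by
        rw [hK, ← Real.rpow_mul (by positivity), div_mul_div_cancel₀' (by positivity),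
          div_self (by positivity), Real.rpow_one]
  rw [le_div_iff₀ hpos] at h3
  linarith

/-- The Gagliardo–Nirenberg–Sobolev inequality in the plane with exponents `2` and `1`. -/
lemma exists_integral_sq_le_sq_integral_fderiv :
    ∃ A : ℝ, 0 < A ∧ ∀ f : E2 → ℝ, ContDiff ℝ 1 f → HasCompactSupport f →
      ∫ x, f x ^ 2 ≤ A * (∫ x, ‖fderiv ℝ f x‖) ^ 2 := by
  set C := eLpNormLESNormFDerivOneConst (volume : Measure E2) ((2 : NNReal) : ℝ)
  refine ⟨(C : ℝ) ^ 2 + 1, by positivity, fun f hf hc => ?_⟩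
  have hp : NNReal.HolderConjugate (Module.finrank ℝ E2 : NNReal) 2 := by
    rw [finrank_euclideanSpace_fin]
    exact_mod_cast NNReal.HolderConjugate.two_two
  have h := eLpNorm_le_eLpNorm_fderiv_one volume hf hc hp
  have hD : Continuous (fderiv ℝ f) := hf.continuous_fderiv (by simp)
  have hDi : Integrable (fderiv ℝ f) := hD.integrable_of_hasCompactSupport (hc.fderiv ℝ)
  have hf2 : MemLp f 2 volume := hf.continuous.memLp_of_hasCompactSupport hc
  have hD0 : 0 ≤ ∫ x, ‖fderiv ℝ f x‖ := integral_nonneg fun x => norm_nonneg _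
  rw [ENNReal.coe_ofNat, hf2.eLpNorm_eq_integral_rpow_norm (by simp) (by simp),
    eLpNorm_one_eq_lintegral_enorm, ← ofReal_integral_norm_eq_lintegral_enorm hDi,
    ← ENNReal.ofReal_coe_nnreal, ← ENNReal.ofReal_mul (by positivity),
    ENNReal.ofReal_le_ofReal_iff (by positivity)] at h
  simp only [ENNReal.toReal_ofNat, Real.rpow_two, Real.norm_eq_abs, sq_abs] at h
  have hI0 : 0 ≤ ∫ x, f x ^ 2 := integral_nonneg fun x => sq_nonneg _
  have hsqrt : (∫ x, f x ^ 2) = ((∫ x, f x ^ 2) ^ (2 : ℝ)⁻¹) ^ 2 := by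
    rw [← Real.rpow_natCast, ← Real.rpow_mul hI0]
    norm_num
  rw [hsqrt]
  calc ((∫ x, f x ^ 2) ^ (2 : ℝ)⁻¹) ^ 2 ≤ (C * ∫ x, ‖fderiv ℝ f x‖) ^ 2 := by
        gcongr
    _ = (C : ℝ) ^ 2 * (∫ x, ‖fderiv ℝ f x‖) ^ 2 := by ring
    _ ≤ _ := by gcongr; linarith

lemma deriv_smoothTransition_eq_zero {x : ℝ} (hx : x ≤ 0 ∨ 1 ≤ x) :
    deriv Real.smoothTransition x = 0 := by
  rcases hx with hx | hx
  · refine IsLocalMin.deriv_eq_zero (Eventually.of_forall fun y => ?_)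
    rw [Real.smoothTransition.zero_of_nonpos hx]
    exact Real.smoothTransition.nonneg y
  · refine IsLocalMax.deriv_eq_zero (Eventually.of_forall fun y => ?_)
    rw [Real.smoothTransition.one_of_one_le hx]
    exact Real.smoothTransition.le_one y

lemma exists_abs_deriv_smoothTransition_le :
    ∃ L : ℝ, 0 < L ∧ ∀ x, |deriv Real.smoothTransition x| ≤ L := by
  have hcont : Continuous (deriv Real.smoothTransition) :=
    (Real.smoothTransition.contDiff (n := 1)).continuous_deriv (by simp)
  obtain ⟨L, hL⟩ := isCompact_Icc.exists_bound_of_continuousOn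
    (s := Icc (0 : ℝ) 1) hcont.continuousOn
  refine ⟨|L| + 1, by positivity, fun x => ?_⟩
  by_cases hx : x ∈ Icc (0 : ℝ) 1
  · exact (hL x hx).trans ((le_abs_self L).trans (by linarith))
  · have : x ≤ 0 ∨ 1 ≤ x := by
      by_contra! h
      exact hx ⟨h.1.le, h.2.le⟩
    rw [deriv_smoothTransition_eq_zero this, abs_zero]
    positivity

lemma sq_setIntegral_le {S : Set E2} {g : E2 → ℝ} (hS : volume S ≠ ∞) (hg : IntegrableOn g S)
    (hg2 : IntegrableOn (fun x => g x ^ 2) S) :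
    (∫ x in S, g x) ^ 2 ≤ (volume S).toReal * ∫ x in S, g x ^ 2 := by
  have hkey : ∀ a : ℝ, 0 ≤ (volume S).toReal * (a * a) + (-2 * ∫ x in S, g x) * a +
      ∫ x in S, g x ^ 2 := by
    intro a
    have h0 : 0 ≤ ∫ x in S, (g x - a) ^ 2 := integral_nonneg fun x => sq_nonneg _
    have hconst : IntegrableOn (fun _ => a ^ 2) S := integrableOn_const hS
    have heq : ∫ x in S, (g x - a) ^ 2 = ∫ x in S, ((g x ^ 2 - 2 * a * g x) + a ^ 2) := by
      congr 1
      ext x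
      ring
    have hdiff : IntegrableOn (fun x => g x ^ 2 - 2 * a * g x) S := hg2.sub (hg.const_mul (2 * a))
    rw [heq, integral_add hdiff hconst,
      integral_sub hg2 (hg.const_mul (2 * a)), integral_const_mul, setIntegral_const,
      smul_eq_mul, Measure.real] at h0
    linarith
  have := discrim_le_zero hkey
  rw [discrim] at this
  linarith

/-- A capacity-type estimate comparing two superlevel sets of `|u|`. -/
lemma exists_sq_sub_mul_volume_le :
    ∃ A : ℝ, 0 < A ∧ ∀ u : E2 → ℝ, ContDiff ℝ (⊤ : ℕ∞) u → HasCompactSupport u →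
      ∀ s t : ℝ, 0 ≤ s → s < t → (t - s) ^ 2 * (volume {x | t < |u x|}).toReal ≤
        A * (volume {x | s < |u x|}).toReal *
          ∫ x in {x | |u x| ∈ Ioo s t}, ‖fderiv ℝ u x‖ ^ 2 := by
  obtain ⟨A, hA, hgns⟩ := exists_integral_sq_le_sq_integral_fderiv
  obtain ⟨L, hL, hL'⟩ := exists_abs_deriv_smoothTransition_le
  refine ⟨A * (2 * L) ^ 2, by positivity, fun u hu hc s t hs hst => ?_⟩
  have hst' : 0 < t - s := sub_pos.2 hst
  set S := {x | |u x| ∈ Ioo s t} with hS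
  have hSm : MeasurableSet S := hu.continuous.abs.measurable measurableSet_Ioo
  have hSsub : S ⊆ {x | s < |u x|} := fun x hx => hx.1
  have hSle : (volume S).toReal ≤ (volume {x | s < |u x|}).toReal :=
    ENNReal.toReal_mono (volume_lt_abs_ne_top hc hs) (measure_mono hSsub)
  have hSfin : volume S ≠ ∞ :=
    ne_top_of_le_ne_top (volume_lt_abs_ne_top hc hs) (measure_mono hSsub)
  set χ := Real.smoothTransition
  have hχ : ContDiff ℝ 1 χ := Real.smoothTransition.contDiff (n := 1)
  have hu1 : ContDiff ℝ 1 u := hu.of_le (by simp)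
  set f : E2 → ℝ := fun x => χ ((u x - s) / (t - s)) + χ ((-u x - s) / (t - s)) with hf
  have hfs : ContDiff ℝ 1 f :=
    (hχ.comp ((hu1.sub contDiff_const).div_const _)).add
      (hχ.comp ((hu1.neg.sub contDiff_const).div_const _))
  have hfc : HasCompactSupport f := by
    refine hc.comp_left (g := fun y : ℝ => χ ((y - s) / (t - s)) + χ ((-y - s) / (t - s))) ?_
    have : (0 - s) / (t - s) ≤ 0 := div_nonpos_of_nonpos_of_nonneg (by linarith) hst'.le
    have h0 := Real.smoothTransition.zero_of_nonpos this
    simp only [neg_zero, χ, h0, add_zero]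
  have hfd : ∀ x, fderiv ℝ f x =
      ((deriv χ ((u x - s) / (t - s)) - deriv χ ((-u x - s) / (t - s))) / (t - s)) •
        fderiv ℝ u x := by
    intro x
    have hux : HasFDerivAt u (fderiv ℝ u x) x := (hu1.differentiable (by simp) x).hasFDerivAt
    have hχd : ∀ y, HasDerivAt χ (deriv χ y) y := fun y =>
      (hχ.differentiable (by simp) y).hasDerivAt
    have h1 := (hχd ((u x - s) / (t - s))).comp_hasFDerivAt x
      ((hux.sub_const s).mul_const (t - s)⁻¹)
    have h2 := (hχd ((-u x - s) / (t - s))).comp_hasFDerivAt x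
      ((hux.neg.sub_const s).mul_const (t - s)⁻¹)
    have h3 : HasFDerivAt f (deriv χ ((u x - s) / (t - s)) • (t - s)⁻¹ • fderiv ℝ u x +
        deriv χ ((-u x - s) / (t - s)) • (t - s)⁻¹ • -fderiv ℝ u x) x := h1.add h2
    rw [h3.fderiv]
    ext y
    simp
    ring
  have hfle : ∀ x, ‖fderiv ℝ f x‖ ≤ S.indicator (fun x => 2 * L / (t - s) * ‖fderiv ℝ u x‖) x := by
    intro x
    rw [hfd, norm_smul]
    by_cases hx : x ∈ S
    · rw [indicator_of_mem hx]
      gcongr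
      rw [norm_div, Real.norm_of_nonneg hst'.le]
      gcongr
      calc _ ≤ |deriv χ ((u x - s) / (t - s))| + |deriv χ ((-u x - s) / (t - s))| := abs_sub _ _
        _ ≤ L + L := add_le_add (hL' _) (hL' _)
        _ = 2 * L := by ring
    · rw [indicator_of_notMem hx]
      have hz : ∀ y : ℝ, |y| = |u x| → deriv χ ((y - s) / (t - s)) = 0 := by
        intro y hy
        refine deriv_smoothTransition_eq_zero ?_
        rw [one_le_div hst', div_nonpos_iff]
        by_contra! hcon
        refine hx ⟨?_, ?_⟩
        · rw [← hy]
          have h1 : 0 < y - s := by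
            by_contra! h
            exact absurd (hcon.1.2 h) (not_lt.2 hst'.le)
          exact lt_of_lt_of_le (by linarith) (le_abs_self y)
        · rw [← hy, abs_lt]
          have h1 : 0 < y - s := by
            by_contra! h
            exact absurd (hcon.1.2 h) (not_lt.2 hst'.le)
          constructor <;> linarith [hcon.2]
      rw [hz (u x) rfl, hz (-u x) (abs_neg _)]
      simp
  have hDu : Continuous (fderiv ℝ u) := hu1.continuous_fderiv (by simp)
  have hDui : Integrable fun x => ‖fderiv ℝ u x‖ :=
    (hDu.integrable_of_hasCompactSupport (hc.fderiv ℝ)).norm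
  have hDfi : Integrable fun x => ‖fderiv ℝ f x‖ :=
    ((hfs.continuous_fderiv (by simp)).integrable_of_hasCompactSupport (hfc.fderiv ℝ)).norm
  have h1 : ∫ x, ‖fderiv ℝ f x‖ ≤ 2 * L / (t - s) * ∫ x in S, ‖fderiv ℝ u x‖ := by
    rw [← integral_const_mul, ← integral_indicator hSm]
    exact integral_mono hDfi ((hDui.const_mul _).indicator hSm) hfle
  have hT : MeasurableSet {x | t < |u x|} :=
    measurableSet_lt measurable_const hu.continuous.abs.measurable
  have h2 : (volume {x | t < |u x|}).toReal ≤ ∫ x, f x ^ 2 := by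
    have : (volume {x | t < |u x|}).toReal =
        ∫ x, {x | t < |u x|}.indicator (fun _ => (1 : ℝ)) x := by
      rw [integral_indicator hT, setIntegral_const, smul_eq_mul, mul_one, Measure.real]
    rw [this]
    refine integral_mono ((integrable_indicator_iff hT).2
      (integrableOn_const (volume_lt_abs_ne_top hc (hs.trans hst.le)))) ?_ fun x => ?_
    · have hcont : Continuous fun x => f x ^ 2 := hfs.continuous.pow 2
      exact hcont.integrable_of_hasCompactSupport
        (hfc.comp_left (g := fun y : ℝ => y ^ 2) (by simp))
    · by_cases hx : t < |u x|
      · rw [indicator_of_mem (show x ∈ {x | t < |u x|} from hx)]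
        have hone : ∀ y, t < y → χ ((y - s) / (t - s)) = 1 := fun y hy =>
          Real.smoothTransition.one_of_one_le ((one_le_div hst').2 (by linarith))
        have hn1 := Real.smoothTransition.nonneg ((u x - s) / (t - s))
        have hn2 := Real.smoothTransition.nonneg ((-u x - s) / (t - s))
        refine one_le_pow₀ ?_
        rcases lt_abs.1 hx with h | h
        · have := hone _ h
          simp only [hf]
          linarith
        · have := hone _ h
          simp only [hf]
          linarith
      · rw [indicator_of_notMem (show x ∉ {x | t < |u x|} from hx)]
        positivity
  have h3 := sq_setIntegral_le hSfin hDui.integrableOn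
    (integrable_sq_norm_fderiv hu hc).integrableOn
  have h4 := hgns f hfs hfc
  have hJ : 0 ≤ ∫ x in S, ‖fderiv ℝ u x‖ ^ 2 := integral_nonneg fun x => by positivity
  have hDf0 : 0 ≤ ∫ x, ‖fderiv ℝ f x‖ := integral_nonneg fun x => norm_nonneg _
  calc (t - s) ^ 2 * (volume {x | t < |u x|}).toReal
      ≤ (t - s) ^ 2 * (A * (2 * L / (t - s) * ∫ x in S, ‖fderiv ℝ u x‖) ^ 2) := by
        gcongr
        exact h2.trans (h4.trans (by gcongr))
    _ = A * (2 * L) ^ 2 * (∫ x in S, ‖fderiv ℝ u x‖) ^ 2 := by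
        field_simp
    _ ≤ A * (2 * L) ^ 2 * ((volume S).toReal * ∫ x in S, ‖fderiv ℝ u x‖ ^ 2) := by gcongr
    _ ≤ A * (2 * L) ^ 2 * ((volume {x | s < |u x|}).toReal * ∫ x in S, ‖fderiv ℝ u x‖ ^ 2) := by
        gcongr
    _ = _ := by ring

lemma IsTestFun.volume_lt_abs_le {Ω : Set E2} {u : E2 → ℝ} (hu : IsTestFun Ω u) {s : ℝ}
    (hs : 0 ≤ s) : volume {x | s < |u x|} ≤ volume Ω := by
  refine measure_mono fun x hx => hu.2.2 (subset_tsupport u fun h => ?_)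
  have hx' : s < |u x| := hx
  rw [h, abs_zero] at hx'
  exact absurd hx' (not_lt.2 hs)

/-- Every superlevel set of `u ^ 2` at height proportional to `n` times the energy has measure at
most `2 ^ (-n)` times that of `Ω`. -/
lemma exists_volume_lt_sq_le :
    ∃ A : ℝ, 0 < A ∧ ∀ (Ω : Set E2) (u : E2 → ℝ), volume Ω ≠ ∞ → IsTestFun Ω u → ∀ n : ℕ,
      volume {x | A * n * ∫ x, ‖fderiv ℝ u x‖ ^ 2 < u x ^ 2} ≤ volume Ω / 2 ^ n := by
  obtain ⟨A, hA, hcap⟩ := exists_sq_sub_mul_volume_le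
  refine ⟨2 * A, by positivity, fun Ω u hΩ hu n => ?_⟩
  rcases eq_or_ne (volume Ω) 0 with h0 | h0
  · rw [h0, ENNReal.zero_div, ← h0]
    refine le_trans (measure_mono fun x hx => ?_) (hu.volume_lt_abs_le le_rfl)
    have hx' : 2 * A * n * ∫ x, ‖fderiv ℝ u x‖ ^ 2 < u x ^ 2 := hx
    have hG : 0 ≤ ∫ x, ‖fderiv ℝ u x‖ ^ 2 := integral_nonneg fun x => by positivity
    have : 0 < u x ^ 2 := lt_of_le_of_lt (by positivity) hx'
    exact abs_pos.2 (sq_pos_iff.1 this)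
  have hc := hu.hasCompactSupport
  obtain ⟨B, hB⟩ := exists_abs_le hu.1.continuous hc
  set w : E2 → ℝ := fun x => |u x| with hw
  set m : ℕ → ℝ≥0∞ := fun k => volume Ω / 2 ^ k with hm
  have hmtop : ∀ k, m k ≠ ∞ := fun k => ENNReal.div_ne_top hΩ (by positivity)
  have hmsucc : ∀ k, m k = 2 * m (k + 1) := fun k => by
    simp only [hm, ENNReal.div_eq_inv_mul]
    rw [pow_succ', ENNReal.mul_inv (by simp) (by simp), ← mul_assoc, ← mul_assoc,
      ENNReal.mul_inv_cancel two_ne_zero (by simp), one_mul]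
  set s : ℕ → ℝ := fun k => decrRearr w (m k) with hs
  have hs0 : ∀ k, 0 ≤ s k := fun k => decrRearr_nonneg _ _
  have hlt : ∀ k t, 0 ≤ t → (t < s k ↔ m k < volume {x | t < w x}) := fun k t ht =>
    lt_decrRearr_iff hB ht
  have hvol : ∀ k, volume {x | s k < w x} ≤ m k := fun k =>
    not_lt.1 fun h => lt_irrefl _ ((hlt k (s k) (hs0 k)).2 h)
  have hmono : Monotone s := monotone_nat_of_le_succ fun k => by
    by_contra! h
    have h1 := (hlt k _ (hs0 (k + 1))).1 h
    have h2 : m (k + 1) ≤ m k := by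
      rw [hmsucc k, two_mul]
      exact le_self_add
    exact absurd (h1.trans_le (hvol (k + 1))) (not_lt.2 h2)
  have hszero : s 0 = 0 := by
    refine le_antisymm ?_ (hs0 0)
    by_contra! h
    have := (hlt 0 0 le_rfl).1 h
    simp only [hm, pow_zero, div_one] at this
    exact absurd this (not_lt.2 (hu.volume_lt_abs_le le_rfl))
  set S : ℕ → Set E2 := fun k => {x | |u x| ∈ Ioo (s k) (s (k + 1))} with hS
  have hSm : ∀ k, MeasurableSet (S k) := fun k =>
    hu.1.continuous.abs.measurable measurableSet_Ioo
  have hint := integrable_sq_norm_fderiv hu.1 hc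
  have hstep : ∀ k, (s (k + 1) - s k) ^ 2 ≤ 2 * A * ∫ x in S k, ‖fderiv ℝ u x‖ ^ 2 := by
    intro k
    have hD : 0 ≤ ∫ x in S k, ‖fderiv ℝ u x‖ ^ 2 := integral_nonneg fun x => by positivity
    rcases (hmono k.le_succ).eq_or_lt with h | h
    · have h' : s (k + 1) - s k = 0 := by
        rw [sub_eq_zero]
        exact h.symm
      rw [h', zero_pow two_ne_zero]
      exact mul_nonneg (by positivity) hD
    have hkey : ∀ t ∈ Ioo (s k) (s (k + 1)),
        (t - s k) ^ 2 ≤ 2 * A * ∫ x in S k, ‖fderiv ℝ u x‖ ^ 2 := by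
      intro t ht
      have ht0 : 0 ≤ t := (hs0 k).trans ht.1.le
      have h1 := hcap u hu.1 hc (s k) t (hs0 k) ht.1
      have h2 : (m (k + 1)).toReal ≤ (volume {x | t < |u x|}).toReal :=
        ENNReal.toReal_mono (volume_lt_abs_ne_top hc ht0) ((hlt _ _ ht0).1 ht.2).le
      have h3 : (volume {x | s k < |u x|}).toReal ≤ 2 * (m (k + 1)).toReal := by
        have := ENNReal.toReal_mono (hmtop k) (hvol k)
        rwa [hmsucc k, ENNReal.toReal_mul, ENNReal.toReal_ofNat] at this
      have h4 : ∫ x in {x | |u x| ∈ Ioo (s k) t}, ‖fderiv ℝ u x‖ ^ 2 ≤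
          ∫ x in S k, ‖fderiv ℝ u x‖ ^ 2 :=
        setIntegral_mono_set hint.integrableOn (Eventually.of_forall fun x => by positivity)
          (Eventually.of_forall fun x hx => ⟨hx.1, hx.2.trans ht.2⟩)
      have hmpos : 0 < (m (k + 1)).toReal :=
        ENNReal.toReal_pos (ENNReal.div_pos h0 (by simp)).ne' (hmtop _)
      have h5 : 0 ≤ ∫ x in {x | |u x| ∈ Ioo (s k) t}, ‖fderiv ℝ u x‖ ^ 2 :=
        integral_nonneg fun x => by positivity
      refine le_of_mul_le_mul_right ?_ hmpos
      calc (t - s k) ^ 2 * (m (k + 1)).toReal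
          ≤ (t - s k) ^ 2 * (volume {x | t < |u x|}).toReal := by gcongr
        _ ≤ _ := h1
        _ ≤ A * (2 * (m (k + 1)).toReal) * ∫ x in S k, ‖fderiv ℝ u x‖ ^ 2 := by gcongr
        _ = _ := by ring
    have hcl : s (k + 1) ∈ closure (Ioo (s k) (s (k + 1))) := by
      rw [closure_Ioo h.ne]
      exact right_mem_Icc.2 h.le
    exact closure_minimal (t := {t | (t - s k) ^ 2 ≤ 2 * A * ∫ x in S k, ‖fderiv ℝ u x‖ ^ 2})
      hkey (isClosed_le (by fun_prop) continuous_const) hcl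
  have hsum : ∑ k ∈ Finset.range n, ∫ x in S k, ‖fderiv ℝ u x‖ ^ 2 ≤
      ∫ x, ‖fderiv ℝ u x‖ ^ 2 := by
    rw [← integral_biUnion_finset _ (fun k _ => hSm k) ?_ fun k _ => hint.integrableOn]
    · exact setIntegral_le_integral hint (Eventually.of_forall fun x => by positivity)
    · intro i _ j _ hij
      exact (hmono.pairwise_disjoint_on_Ioo_succ hij).preimage _
  have hsn : s n ^ 2 ≤ 2 * A * n * ∫ x, ‖fderiv ℝ u x‖ ^ 2 := by
    have htel : s n = ∑ k ∈ Finset.range n, (s (k + 1) - s k) := by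
      rw [Finset.sum_range_sub, hszero, sub_zero]
    calc s n ^ 2 ≤ n * ∑ k ∈ Finset.range n, (s (k + 1) - s k) ^ 2 := by
          rw [htel]
          simpa using sq_sum_le_card_mul_sum_sq (s := Finset.range n)
            (f := fun k => s (k + 1) - s k)
      _ ≤ n * ∑ k ∈ Finset.range n, 2 * A * ∫ x in S k, ‖fderiv ℝ u x‖ ^ 2 := by
          gcongr with k
          exact hstep k
      _ = 2 * A * n * ∑ k ∈ Finset.range n, ∫ x in S k, ‖fderiv ℝ u x‖ ^ 2 := by
          rw [← Finset.mul_sum]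
          ring
      _ ≤ _ := by gcongr
  refine le_trans (measure_mono fun x hx => ?_) (hvol n)
  have hx' : 2 * A * n * ∫ x, ‖fderiv ℝ u x‖ ^ 2 < u x ^ 2 := hx
  have := hsn.trans_lt hx'
  rw [← sq_abs (u x)] at this
  exact lt_of_pow_lt_pow_left₀ 2 (abs_nonneg _) this

/-- If the superlevel sets of `f ≥ 0` at the heights `n * a` have measure at most `V / 2 ^ n`,
then `f` is exponentially integrable. -/
lemma lintegral_exp_sub_one_le {f : E2 → ℝ} {a q : ℝ} {V : ℝ≥0∞} (hf : Measurable f)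
    (ha : 0 < a) (hq : 1 < q) (h : ∀ n : ℕ, volume {x | n * a < f x} ≤ V / 2 ^ n) :
    ∫⁻ x, ENNReal.ofReal (Real.exp (Real.log q / a * f x) - 1) ≤
      ENNReal.ofReal (q - 1) * V * (1 - ENNReal.ofReal (q / 2))⁻¹ := by
  have hS : ∀ n : ℕ, MeasurableSet {x | n * a < f x} := fun n =>
    measurableSet_lt measurable_const hf
  have hpt : ∀ x, ENNReal.ofReal (Real.exp (Real.log q / a * f x) - 1) ≤
      ∑' n : ℕ, {x | n * a < f x}.indicator
        (fun _ => ENNReal.ofReal ((q - 1) * q ^ n)) x := by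
    intro x
    classical
    have hex : ∃ n : ℕ, f x ≤ n * a := by
      obtain ⟨n, hn⟩ := exists_nat_ge (f x / a)
      exact ⟨n, (div_le_iff₀ ha).1 hn⟩
    set n := Nat.find hex with hn
    have hle : f x ≤ n * a := Nat.find_spec hex
    have hlt : ∀ k < n, k * a < f x := fun k hk => not_le.1 (Nat.find_min hex hk)
    calc ENNReal.ofReal (Real.exp (Real.log q / a * f x) - 1)
        ≤ ENNReal.ofReal (q ^ n - 1) := by
          refine ENNReal.ofReal_le_ofReal (sub_le_sub_right ?_ 1)
          have : q ^ n = Real.exp (Real.log q / a * (n * a)) := by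
            rw [show Real.log q / a * (n * a) = n * Real.log q by field_simp, Real.exp_nat_mul,
              Real.exp_log (by linarith)]
          rw [this]
          have := Real.log_pos hq
          gcongr
      _ = ENNReal.ofReal (∑ k ∈ Finset.range n, (q - 1) * q ^ k) := by
          rw [← Finset.mul_sum, mul_geom_sum]
      _ = ∑ k ∈ Finset.range n, ENNReal.ofReal ((q - 1) * q ^ k) :=
          ENNReal.ofReal_sum_of_nonneg fun k _ =>
            mul_nonneg (by linarith) (pow_nonneg (by linarith) k)
      _ = ∑ k ∈ Finset.range n, {x | k * a < f x}.indicator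
            (fun _ => ENNReal.ofReal ((q - 1) * q ^ k)) x :=
          Finset.sum_congr rfl fun k hk => (indicator_of_mem (s := {x | k * a < f x})
            (hlt k (Finset.mem_range.1 hk)) fun _ => ENNReal.ofReal ((q - 1) * q ^ k)).symm
      _ ≤ _ := ENNReal.sum_le_tsum _
  have hhalf : ENNReal.ofReal (q / 2) = ENNReal.ofReal q / 2 := by
    rw [ENNReal.ofReal_div_of_pos two_pos, ENNReal.ofReal_ofNat]
  calc _ ≤ ∫⁻ x, ∑' n : ℕ, {x | n * a < f x}.indicator
        (fun _ => ENNReal.ofReal ((q - 1) * q ^ n)) x := lintegral_mono hpt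
    _ = ∑' n : ℕ, ENNReal.ofReal ((q - 1) * q ^ n) * volume {x | n * a < f x} := by
        rw [lintegral_tsum fun n => (measurable_const.indicator (hS n)).aemeasurable]
        exact tsum_congr fun n => lintegral_indicator_const (hS n) _
    _ ≤ ∑' n : ℕ, ENNReal.ofReal (q - 1) * V * ENNReal.ofReal (q / 2) ^ n := by
        refine ENNReal.tsum_le_tsum fun n => (mul_le_mul_right (h n) _).trans_eq ?_
        rw [ENNReal.ofReal_mul (by linarith), ENNReal.ofReal_pow (by linarith), hhalf,
          ENNReal.div_eq_inv_mul, ENNReal.div_eq_inv_mul, mul_pow, ENNReal.inv_pow]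
        ring
    _ = _ := by rw [ENNReal.tsum_mul_left, ENNReal.tsum_geometric]

lemma orlNorm_nonneg (Ω : Set E2) (u : E2 → ℝ) : 0 ≤ orlNorm Ω u :=
  Real.sInf_nonneg fun _ hk => hk.1.le

lemma orlNorm_le {Ω : Set E2} {u : E2 → ℝ} {k : ℝ} (hk : 0 < k)
    (h : ∫ x in Ω, (Real.exp (4 * π * u x ^ 2 / k ^ 2) - 1) ≤ 1) : orlNorm Ω u ≤ k :=
  csInf_le ⟨0, fun _ hk => hk.1.le⟩ ⟨hk, h⟩

/-- Trudinger's inequality: the Orlicz norm is controlled by the Dirichlet energy. -/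
lemma exists_sq_orlNorm_le {Ω : Set E2} (hΩ : volume Ω ≠ ∞) :
    ∃ K : ℝ, 0 < K ∧ ∀ u : E2 → ℝ, IsTestFun Ω u →
      orlNorm Ω u ^ 2 ≤ K * ∫ x, ‖fderiv ℝ u x‖ ^ 2 := by
  obtain ⟨A, hA, hdec⟩ := exists_volume_lt_sq_le
  set V := (volume Ω).toReal with hV
  have hV0 : 0 ≤ V := ENNReal.toReal_nonneg
  set q : ℝ := 1 + 1 / (4 * V + 2) with hq
  have hq1 : 1 < q := by
    rw [hq, lt_add_iff_pos_right]
    positivity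
  have hq2 : 1 / (4 * V + 2) ≤ 1 / 2 := by gcongr; linarith
  have hlog := Real.log_pos hq1
  refine ⟨4 * π * A / Real.log q, by positivity, fun u hu => ?_⟩
  set G := ∫ x, ‖fderiv ℝ u x‖ ^ 2 with hG
  have hG0 : 0 ≤ G := integral_nonneg fun x => by positivity
  have hbound : ∀ G' > G, orlNorm Ω u ^ 2 ≤ 4 * π * A / Real.log q * G' := by
    intro G' hG'
    have hG'0 : 0 < G' := hG0.trans_lt hG'
    have hK : 0 < 4 * π * A / Real.log q * G' := by positivity
    rw [← Real.sq_sqrt hK.le]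
    refine pow_le_pow_left₀ (orlNorm_nonneg _ _) (orlNorm_le (Real.sqrt_pos.2 hK) ?_) 2
    rw [Real.sq_sqrt hK.le]
    have hexp : ∀ x, 4 * π * u x ^ 2 / (4 * π * A / Real.log q * G') =
        Real.log q / (A * G') * u x ^ 2 := fun x => by field_simp
    simp only [hexp]
    have hnn : ∀ x, 0 ≤ Real.exp (Real.log q / (A * G') * u x ^ 2) - 1 := fun x =>
      sub_nonneg.2 (Real.one_le_exp (by positivity))
    have hmeas : Measurable fun x => u x ^ 2 := hu.1.continuous.measurable.pow_const 2
    have hl := lintegral_exp_sub_one_le (a := A * G') hmeas (by positivity) hq1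
      (V := volume Ω) fun n => by
        refine le_trans (measure_mono fun x hx => ?_) (hdec Ω u hΩ hu n)
        have hx' : n * (A * G') < u x ^ 2 := hx
        refine lt_of_le_of_lt ?_ hx'
        calc A * n * G ≤ A * n * G' := by gcongr
          _ = _ := by ring
    have hone : ENNReal.ofReal (q - 1) * volume Ω * (1 - ENNReal.ofReal (q / 2))⁻¹ ≤ 1 := by
      have hpos : 0 < 1 - q / 2 := by linarith
      rw [← ENNReal.ofReal_toReal hΩ, ← hV, ← ENNReal.ofReal_one,
        ← ENNReal.ofReal_sub _ (by linarith), ← ENNReal.ofReal_inv_of_pos hpos,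
        ← ENNReal.ofReal_mul (by linarith),
        ← ENNReal.ofReal_mul (mul_nonneg (by linarith) hV0)]
      refine ENNReal.ofReal_le_ofReal ?_
      rw [← div_eq_mul_inv, div_le_one hpos]
      have h1 : (q - 1) * V ≤ 1 / 4 := by
        rw [hq, add_sub_cancel_left, div_mul_eq_mul_div, one_mul, div_le_iff₀ (by positivity)]
        linarith
      linarith
    rw [integral_eq_lintegral_of_nonneg_ae (Eventually.of_forall hnn)
      (((hmeas.const_mul _).exp.sub_const 1).aestronglyMeasurable)]
    refine ENNReal.toReal_le_of_le_ofReal zero_le_one ?_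
    rw [ENNReal.ofReal_one]
    exact (setLIntegral_le_lintegral _ _).trans (hl.trans hone)
  have hK : 0 < 4 * π * A / Real.log q := by positivity
  rw [← div_le_iff₀' hK]
  exact le_of_forall_gt_imp_ge_of_dense fun G' hG' => (div_le_iff₀' hK).2 (hbound G' hG')

/-- `∫|∇u|² - λ‖u‖_p² ≥ C ‖u‖_Orl²` for `2 < p < ∞`, `0 < λ < λ_p`. -/
theorem orlicz_remainder_Lp (Ω : Set E2) (hne : Ω.Nonempty) (hO : IsOpen Ω)
    (hb : Bornology.IsBounded Ω) (p lam : ℝ) (hp : 2 < p)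
    (hlam0 : 0 < lam) (hlam : lam < lambdaP Ω p) :
    ∃ C : ℝ, 0 < C ∧ ∀ u : E2 → ℝ, IsTestFun Ω u →
      C * orlNorm Ω u ^ 2 ≤
        (∫ x in Ω, ‖fderiv ℝ u x‖ ^ 2) - lam * (∫ x in Ω, |u x| ^ p) ^ (2 / p) := by
  obtain ⟨K, hK, hT⟩ := exists_sq_orlNorm_le hb.measure_lt_top.ne
  have hΛ : 0 < lambdaP Ω p := hlam0.trans hlam
  have hθ : 0 < 1 - lam / lambdaP Ω p := sub_pos.2 ((div_lt_one hΛ).2 hlam)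
  refine ⟨(1 - lam / lambdaP Ω p) / K, by positivity, fun u hu => ?_⟩
  have h1 := hT u hu
  rw [← hu.setIntegral_sq_fderiv] at h1
  have h2 := lambdaP_mul_setIntegral_rpow_le hne hO hb (by linarith) hΛ hu
  set G := ∫ x in Ω, ‖fderiv ℝ u x‖ ^ 2
  set N := (∫ x in Ω, |u x| ^ p) ^ (2 / p)
  calc (1 - lam / lambdaP Ω p) / K * orlNorm Ω u ^ 2
      ≤ (1 - lam / lambdaP Ω p) / K * (K * G) := by gcongr
    _ = G - lam / lambdaP Ω p * G := by field_simp
    _ ≤ G - lam / lambdaP Ω p * (lambdaP Ω p * N) := by gcongr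
    _ = G - lam * N := by field_simp
end
end

section
/- Let V_Leray(r) = 1/(4 r² (log(1/r))²) for r ∈ (0,1). Then the supremum of ∫_B e^{4π u(x)²} dx over all u ∈ C_c^∞(B) with Q_{V_Leray}(u) ≤ 1 is infinite; that is, for every C > 0 there exists u ∈ C_c^∞(B) with Q_{V_Leray}(u) ≤ 1 and ∫_B e^{4π u(x)²} dx > C. -/
open MeasureTheory Real Set Filter
open scoped ENNReal

noncomputable section

/-- The open unit disk in ℝ². -/
def unitDisk : Set E2 := Metric.ball 0 1

/-- The quadratic form `Q_V(u) = ∫_B |∇u|² - ∫_B V(|x|) u²`. -/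
def QV (V : ℝ → ℝ) (u : E2 → ℝ) : ℝ :=
  (∫ x in unitDisk, ‖fderiv ℝ u x‖ ^ 2) - ∫ x in unitDisk, V ‖x‖ * u x ^ 2

/-- Weak coercivity of `Q_V`. -/
def WeaklyCoercive (V : ℝ → ℝ) : Prop :=
  ∃ E : Set E2, IsOpen E ∧ IsCompact (closure E) ∧ closure E ⊆ unitDisk ∧
    ∃ δ : ℝ, 0 < δ ∧ ∀ u : E2 → ℝ, IsTestFun unitDisk u →
      δ * (∫ x in E, u x) ^ 2 ≤ QV V u

/-- The class 𝒱 of radial potentials. -/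
def MemClassV (V : ℝ → ℝ) : Prop :=
  ContinuousOn V (Ioo 0 1) ∧ (∀ r ∈ Ioo (0:ℝ) 1, 0 ≤ V r) ∧
    AntitoneOn (fun r => (1 - r ^ 2) ^ 2 * V r) (Ioo 0 1)

/-- Condition (K): `r² (log(1/r))^{2+α} V(r) → 0` as `r → 0⁺`, for some `α > 0`. -/
def CondK (V : ℝ → ℝ) : Prop :=
  ∃ α : ℝ, 0 < α ∧
    Tendsto (fun r : ℝ => r ^ 2 * Real.log (1 / r) ^ (2 + α) * V r)
      (nhdsWithin 0 (Ioi 0)) (nhds 0)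

/-- Leray's potential `V(r) = 1/(4 r² (log(1/r))²)`. -/
def VLeray : ℝ → ℝ := fun r => 1 / (4 * r ^ 2 * Real.log (1 / r) ^ 2)

/-- The logarithmic radial coordinate `log (log (1 / ‖x‖))` on the punctured disk. -/
def logLog (x : E2) : ℝ := Real.log (-Real.log ‖x‖)

/-- The radial function equal to `√(log (1 / ‖x‖)) * h (log (log (1 / ‖x‖)))` on the punctured
unit disk, and to `0` elsewhere. -/
def lerayProfile (h : ℝ → ℝ) : E2 → ℝ :=
  (unitDisk \ {0}).indicator fun x => Real.exp (logLog x / 2) * h (logLog x)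

/-- The mass of the unit circle in polar coordinates. -/
def circleMass : ℝ := 2 * (volume : Measure E2).real (Metric.ball 0 1)

lemma circleMass_pos : 0 < circleMass := by
  have : 0 < (volume : Measure E2).real (Metric.ball 0 1) :=
    ENNReal.toReal_pos (Metric.measure_ball_pos _ _ one_pos).ne' measure_ball_lt_top.ne
  unfold circleMass
  positivity

lemma mem_puncturedDisk {x : E2} : x ∈ unitDisk \ {0} ↔ 0 < ‖x‖ ∧ ‖x‖ < 1 := by
  simp [unitDisk, and_comm]

lemma isOpen_puncturedDisk : IsOpen (unitDisk \ {0}) :=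
  Metric.isOpen_ball.sdiff isClosed_singleton

lemma norm_eq_exp_logLog {x : E2} (hx : x ∈ unitDisk \ {0}) :
    ‖x‖ = Real.exp (-Real.exp (logLog x)) := by
  obtain ⟨h0, h1⟩ := mem_puncturedDisk.1 hx
  rw [logLog, Real.exp_log (neg_pos.2 (Real.log_neg h0 h1)), neg_neg, Real.exp_log h0]

lemma image_exp_neg_exp : (fun s : ℝ => Real.exp (-Real.exp s)) '' univ = Ioo 0 1 := by
  ext r
  simp only [image_univ, mem_range, mem_Ioo]
  constructor
  · rintro ⟨s, rfl⟩
    exact ⟨Real.exp_pos _, by simpa using Real.exp_pos s⟩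
  · rintro ⟨h0, h1⟩
    exact ⟨Real.log (-Real.log r), by
      rw [Real.exp_log (neg_pos.2 (Real.log_neg h0 h1)), neg_neg, Real.exp_log h0]⟩

lemma hasDerivAt_exp_neg_exp (s : ℝ) :
    HasDerivAt (fun s : ℝ => Real.exp (-Real.exp s))
      (Real.exp (-Real.exp s) * -Real.exp s) s :=
  (Real.hasDerivAt_exp s).neg.exp

/-- Polar coordinates on the unit disk in the variable `logLog`. -/
lemma setIntegral_unitDisk_eq {F : E2 → ℝ} {f : ℝ → ℝ}
    (hF : ∀ x ∈ unitDisk \ {0}, F x = f (logLog x)) :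
    ∫ x in unitDisk, F x =
      circleMass * ∫ s : ℝ, Real.exp (s - 2 * Real.exp s) * f s := by
  set g : ℝ → ℝ := (Ioo 0 1).indicator fun r => f (Real.log (-Real.log r)) with hg
  have h1 : ∫ x in unitDisk, F x = ∫ x : E2, g ‖x‖ := by
    rw [← integral_indicator (by exact Metric.isOpen_ball.measurableSet)]
    refine integral_congr_ae ?_
    have : ∀ᵐ x : E2, x ≠ 0 := by simp [ae_iff]
    filter_upwards [this] with x hx
    by_cases hxB : x ∈ unitDisk
    · rw [indicator_of_mem hxB, hF x ⟨hxB, hx⟩, hg,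
        indicator_of_mem (by exact mem_puncturedDisk.1 ⟨hxB, hx⟩)]
      rfl
    · rw [indicator_of_notMem hxB, hg, indicator_of_notMem]
      exact fun h => hxB (mem_puncturedDisk.2 h).1
  have h2 : ∫ y in Ioi (0 : ℝ), y ^ (2 - 1) • g y =
      ∫ y in Ioo (0 : ℝ) 1, y * f (Real.log (-Real.log y)) := by
    rw [← integral_indicator measurableSet_Ioi, ← integral_indicator measurableSet_Ioo]
    congr 1
    ext y
    by_cases hy : y ∈ Ioo (0 : ℝ) 1
    · rw [indicator_of_mem (show y ∈ Ioi 0 from hy.1), indicator_of_mem hy, hg,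
        indicator_of_mem hy]
      simp
    · have hgy : g y = 0 := indicator_of_notMem hy _
      simp [hgy, indicator_of_notMem hy]
  rw [h1, integral_fun_norm_addHaar, finrank_euclideanSpace_fin, h2, ← image_exp_neg_exp,
    integral_image_eq_integral_abs_deriv_smul MeasurableSet.univ
      (fun s _ => (hasDerivAt_exp_neg_exp s).hasDerivWithinAt)
      (fun s _ t _ hst => by simpa using hst), Measure.restrict_univ, circleMass, nsmul_eq_mul,
      smul_eq_mul, ← mul_assoc]
  congr 1
  refine integral_congr_ae (Eventually.of_forall fun s => ?_)
  simp only [Real.log_exp, neg_neg, smul_eq_mul, abs_mul, abs_neg, Real.abs_exp]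
  rw [← mul_assoc, sub_eq_add_neg, Real.exp_add,
    show -(2 * Real.exp s) = -Real.exp s + -Real.exp s by ring, Real.exp_add]
  ring

lemma contDiffAt_logLog {x : E2} (hx : x ∈ unitDisk \ {0}) :
    ContDiffAt ℝ (⊤ : ℕ∞) logLog x := by
  obtain ⟨h0, h1⟩ := mem_puncturedDisk.1 hx
  exact (((contDiffAt_norm ℝ hx.2).log h0.ne').neg).log (neg_pos.2 (Real.log_neg h0 h1)).ne'

lemma lerayProfile_eventuallyEq (h : ℝ → ℝ) {x : E2} (hx : x ∈ unitDisk \ {0}) :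
    lerayProfile h =ᶠ[nhds x] fun y => Real.exp (logLog y / 2) * h (logLog y) := by
  filter_upwards [isOpen_puncturedDisk.mem_nhds hx] with y hy
  exact indicator_of_mem hy _

lemma isTestFun_lerayProfile {h : ℝ → ℝ} (hh : ContDiff ℝ (⊤ : ℕ∞) h)
    (hc : HasCompactSupport h) : IsTestFun unitDisk (lerayProfile h) := by
  obtain ⟨R, hR⟩ := hc.isCompact.isBounded.subset_closedBall 0
  set K : Set E2 := norm ⁻¹' Icc (Real.exp (-Real.exp R)) (Real.exp (-Real.exp (-R)))
  have hKc : IsClosed K := isClosed_Icc.preimage continuous_norm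
  have hKW : K ⊆ unitDisk \ {0} := fun x hx => mem_puncturedDisk.2
    ⟨(Real.exp_pos _).trans_le hx.1, hx.2.trans_lt (by simpa using Real.exp_pos (-R))⟩
  have hKcomp : IsCompact K := (isCompact_closedBall (0 : E2) 1).of_isClosed_subset hKc
    fun x hx => by simpa using (mem_puncturedDisk.1 (hKW hx)).2.le
  have hsupp : Function.support (lerayProfile h) ⊆ K := by
    intro x hx
    have hxW : x ∈ unitDisk \ {0} := by
      by_contra hxW
      exact hx (indicator_of_notMem hxW _)
    have hne : h (logLog x) ≠ 0 := by
      intro h0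
      apply hx
      rw [lerayProfile, indicator_of_mem hxW, h0, mul_zero]
    have hs := hR (subset_tsupport h hne)
    rw [Metric.mem_closedBall, dist_zero_right, Real.norm_eq_abs, abs_le] at hs
    change ‖x‖ ∈ Icc _ _
    rw [norm_eq_exp_logLog hxW]
    constructor <;> gcongr <;> linarith
  have htsupp : tsupport (lerayProfile h) ⊆ K := closure_minimal hsupp hKc
  refine ⟨?_, hKcomp.of_isClosed_subset (isClosed_tsupport _) htsupp,
    htsupp.trans (hKW.trans sdiff_subset)⟩
  rw [contDiff_iff_contDiffAt]
  intro x
  by_cases hx : x ∈ tsupport (lerayProfile h)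
  · have hxW := hKW (htsupp hx)
    have hs := contDiffAt_logLog hxW
    exact ((hs.div_const 2).exp.mul (hh.contDiffAt.comp x hs)).congr_of_eventuallyEq
      (lerayProfile_eventuallyEq h hxW)
  · exact contDiffAt_const.congr_of_eventuallyEq (notMem_tsupport_iff_eventuallyEq.1 hx)

lemma exp_two_mul_exp_sub (s : ℝ) : Real.exp (2 * Real.exp s - s) =
    Real.exp (s / 2) ^ 2 * (Real.exp (-Real.exp s))⁻¹ ^ 2 * (Real.exp s)⁻¹ ^ 2 := by
  rw [← Real.exp_neg, ← Real.exp_neg, ← Real.exp_nat_mul, ← Real.exp_nat_mul,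
    ← Real.exp_nat_mul, ← Real.exp_add, ← Real.exp_add]
  congr 1
  push_cast
  ring

lemma norm_fderiv_lerayProfile_sq {h : ℝ → ℝ} (hh : ContDiff ℝ (⊤ : ℕ∞) h) {x : E2}
    (hx : x ∈ unitDisk \ {0}) :
    ‖fderiv ℝ (lerayProfile h) x‖ ^ 2 =
      Real.exp (2 * Real.exp (logLog x) - logLog x) *
        (h (logLog x) / 2 + deriv h (logLog x)) ^ 2 := by
  obtain ⟨h0, h1⟩ := mem_puncturedDisk.1 hx
  have hlog : -Real.log ‖x‖ ≠ 0 := (neg_pos.2 (Real.log_neg h0 h1)).ne'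
  have hnd : DifferentiableAt ℝ (fun y : E2 => ‖y‖) x :=
    (contDiffAt_norm ℝ hx.2 (n := 1)).differentiableAt one_ne_zero
  have hs : HasDerivAt (fun r => Real.log (-Real.log r)) (-(‖x‖)⁻¹ / -Real.log ‖x‖) ‖x‖ :=
    (Real.hasDerivAt_log h0.ne').neg.log hlog
  have hd : HasDerivAt h (deriv h (logLog x)) (logLog x) :=
    (hh.differentiable (by simp) _).hasDerivAt
  have hU : HasDerivAt (fun s => Real.exp (s / 2) * h s)
      (Real.exp (logLog x / 2) * (1 / 2) * h (logLog x) +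
        Real.exp (logLog x / 2) * deriv h (logLog x)) (logLog x) :=
    ((hasDerivAt_id _).div_const 2).exp.mul hd
  have hcomp := (HasDerivAt.comp ‖x‖ (h₂ := fun s => Real.exp (s / 2) * h s) hU hs).comp_hasFDerivAt
    x hnd.hasFDerivAt
  have hfd : fderiv ℝ (lerayProfile h) x = _ :=
    (lerayProfile_eventuallyEq h hx).fderiv_eq.trans hcomp.fderiv
  have hexp : -Real.log ‖x‖ = Real.exp (logLog x) :=
    (Real.exp_log (neg_pos.2 (Real.log_neg h0 h1))).symm
  rw [hfd, norm_smul, norm_fderiv_norm hnd, mul_one, Real.norm_eq_abs, sq_abs, hexp,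
    norm_eq_exp_logLog hx]
  generalize logLog x = s
  rw [exp_two_mul_exp_sub]
  ring

lemma VLeray_mul_lerayProfile_sq (h : ℝ → ℝ) {x : E2} (hx : x ∈ unitDisk \ {0}) :
    VLeray ‖x‖ * lerayProfile h x ^ 2 =
      Real.exp (2 * Real.exp (logLog x) - logLog x) * (h (logLog x) ^ 2 / 4) := by
  rw [lerayProfile, indicator_of_mem hx, VLeray, norm_eq_exp_logLog hx]
  generalize logLog x = s
  rw [exp_two_mul_exp_sub, one_div (Real.exp _), Real.log_inv, Real.log_exp, neg_neg]
  field_simp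

/-- The ground state representation of the Leray form. -/
lemma QV_VLeray_lerayProfile {h : ℝ → ℝ} (hh : ContDiff ℝ (⊤ : ℕ∞) h)
    (hc : HasCompactSupport h) :
    QV VLeray (lerayProfile h) = circleMass * ∫ s, deriv h s ^ 2 := by
  have hdc : Continuous (deriv h) := hh.continuous_deriv (by simp)
  have hcont := hh.continuous
  have weight (f : ℝ → ℝ) (s : ℝ) :
      Real.exp (s - 2 * Real.exp s) * (Real.exp (2 * Real.exp s - s) * f s) = f s := by
    rw [← mul_assoc, ← Real.exp_add]
    simp
  have sq_integrable {f : ℝ → ℝ} (hf : Continuous f) (hfc : HasCompactSupport f) :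
      Integrable fun s => f s ^ 2 := by
    simp_rw [sq]
    exact (hf.mul hf).integrable_of_hasCompactSupport hfc.mul_left
  have i1 : Integrable fun s => deriv h s ^ 2 := sq_integrable hdc hc.deriv
  have i2 : Integrable fun s => h s ^ 2 := sq_integrable hcont hc
  have i3 : Integrable fun s => 2 * h s * deriv h s :=
    ((continuous_const.mul hcont).mul hdc).integrable_of_hasCompactSupport hc.deriv.mul_left
  have hzero : ∫ s, 2 * h s * deriv h s = 0 := by
    refine integral_eq_zero_of_hasDerivAt_of_integrable (f := fun s => h s ^ 2) (fun s => ?_) i3 i2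
    have hd : HasDerivAt h (deriv h s) s := (hh.differentiable (by simp) s).hasDerivAt
    simpa using hd.fun_pow 2
  rw [QV, setIntegral_unitDisk_eq (f := fun s => Real.exp (2 * Real.exp s - s) *
      (h s / 2 + deriv h s) ^ 2) fun x hx => norm_fderiv_lerayProfile_sq hh hx,
    setIntegral_unitDisk_eq (f := fun s => Real.exp (2 * Real.exp s - s) *
      (h s ^ 2 / 4)) fun x hx => VLeray_mul_lerayProfile_sq h hx]
  simp_rw [weight (fun s => (h s / 2 + deriv h s) ^ 2), weight (fun s => h s ^ 2 / 4)]
  have hsplit : ∫ s, (h s / 2 + deriv h s) ^ 2 =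
      ((∫ s, h s ^ 2 / 4) + ∫ s, 2 * h s * deriv h s / 2) + ∫ s, deriv h s ^ 2 := by
    rw [← integral_add (i2.div_const 4) (i3.div_const 2),
      ← integral_add (f := fun s => h s ^ 2 / 4 + 2 * h s * deriv h s / 2)
        ((i2.div_const 4).add (i3.div_const 2)) i1]
    congr 1
    ext s
    ring
  rw [hsplit, integral_div, integral_div, hzero]
  ring

lemma le_integral_exp_lerayProfile {h : ℝ → ℝ} (hh : ContDiff ℝ (⊤ : ℕ∞) h)
    (hc : HasCompactSupport h) {R : ℝ} (hR : 0 ≤ R) (h1 : ∀ s ∈ Icc 0 R, h s = 1) :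
    circleMass * R ≤ ∫ x in unitDisk, Real.exp (4 * π * lerayProfile h x ^ 2) := by
  set f : ℝ → ℝ := (Icc 0 R).indicator fun s => Real.exp (2 * Real.exp s - s)
  have hlow : ∫ x in unitDisk, (unitDisk \ {0}).indicator (fun x => f (logLog x)) x =
      circleMass * R := by
    rw [setIntegral_unitDisk_eq (f := f) fun x hx => indicator_of_mem hx _]
    have : ∀ s, Real.exp (s - 2 * Real.exp s) * f s = (Icc 0 R).indicator (fun _ => 1) s := by
      intro s
      by_cases hs : s ∈ Icc 0 R
      · simp only [f, indicator_of_mem hs]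
        rw [← Real.exp_add]
        simp
      · simp [f, indicator_of_notMem hs]
    simp_rw [this]
    rw [integral_indicator measurableSet_Icc]
    simp [hR]
  have hf0 : ∀ s, 0 ≤ f s := fun s => indicator_nonneg (fun _ _ => (Real.exp_pos _).le) s
  have hcont : Continuous fun x => Real.exp (4 * π * lerayProfile h x ^ 2) := by
    have := (isTestFun_lerayProfile hh hc).1.continuous
    fun_prop
  rw [← hlow]
  refine integral_mono_of_nonneg
    (Eventually.of_forall fun x => indicator_nonneg (fun _ _ => hf0 _) x) ?_
    (Eventually.of_forall fun x => ?_)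
  · exact (hcont.continuousOn.integrableOn_compact (isCompact_closedBall (0 : E2) 1)).mono_set
      Metric.ball_subset_closedBall
  · by_cases hx : x ∈ unitDisk \ {0}
    · by_cases hs : logLog x ∈ Icc 0 R
      · simp only [lerayProfile, f, indicator_of_mem hx, indicator_of_mem hs, h1 _ hs, mul_one]
        rw [← Real.exp_nat_mul]
        gcongr
        have hpi := Real.pi_gt_three
        have e : ((2 : ℕ) : ℝ) * (logLog x / 2) = logLog x := by push_cast; ring
        rw [e]
        nlinarith [Real.exp_pos (logLog x), hs.1]
      · simp only [f, indicator_of_mem hx, indicator_of_notMem hs]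
        positivity
    · simp only [indicator_of_notMem hx]
      positivity

/-- For the Leray potential, the Trudinger-Moser supremum under the
constraint `Q_{V_Leray}(u) ≤ 1` is infinite. -/
theorem trudinger_moser_leray_infinite :
    ∀ C : ℝ, 0 < C → ∃ u : E2 → ℝ, IsTestFun unitDisk u ∧ QV VLeray u ≤ 1 ∧
      C < ∫ x in unitDisk, Real.exp (4 * π * u x ^ 2) := by
  intro C hC
  let χ : ContDiffBump (0 : ℝ) := ⟨1, 2, one_pos, one_lt_two⟩
  have hχ : ContDiff ℝ (⊤ : ℕ∞) χ := χ.contDiff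
  set A := ∫ s, deriv χ s ^ 2 with hA
  have hA0 : 0 ≤ A := integral_nonneg fun _ => sq_nonneg _
  have hm := circleMass_pos
  obtain ⟨R, hR0, hRA, hRC⟩ : ∃ R : ℝ, 0 < R ∧ circleMass * A ≤ R ∧ C < circleMass * R := by
    refine ⟨circleMass * A + (C + 1) / circleMass, by positivity, ?_, ?_⟩
    · have : 0 < (C + 1) / circleMass := by positivity
      linarith
    · have : circleMass * ((C + 1) / circleMass) = C + 1 := by field_simp
      rw [mul_add, this]
      have : 0 ≤ circleMass * (circleMass * A) := by positivity
      linarith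
  set h : ℝ → ℝ := fun s => χ (R⁻¹ * s) with hdef
  have hh : ContDiff ℝ (⊤ : ℕ∞) h := hχ.comp (contDiff_const.mul contDiff_id)
  have hc : HasCompactSupport h :=
    χ.hasCompactSupport.comp_homeomorph (Homeomorph.mulLeft₀ R⁻¹ (inv_ne_zero hR0.ne'))
  refine ⟨lerayProfile h, isTestFun_lerayProfile hh hc, ?_,
    hRC.trans_le (le_integral_exp_lerayProfile hh hc hR0.le fun s hs => ?_)⟩
  · have hderiv : ∀ s, deriv h s ^ 2 = (R⁻¹) ^ 2 * deriv χ (R⁻¹ * s) ^ 2 := by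
      intro s
      have := ((hχ.differentiable (by simp) (R⁻¹ * s)).hasDerivAt).comp s
        ((hasDerivAt_id s).const_mul R⁻¹)
      have hd : deriv h s = _ := this.deriv
      rw [hd]
      ring
    rw [QV_VLeray_lerayProfile hh hc]
    simp_rw [hderiv]
    rw [integral_const_mul, Measure.integral_comp_mul_left (fun s => deriv χ s ^ 2), ← hA,
      inv_inv, abs_of_pos hR0, smul_eq_mul]
    have : circleMass * (R⁻¹ ^ 2 * (R * A)) = circleMass * A / R := by field_simp
    rw [this]
    exact (div_le_one hR0).2 hRA
  · refine χ.one_of_mem_closedBall ?_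
    have : R⁻¹ * s ≤ 1 := by
      rw [inv_mul_le_iff₀ hR0, mul_one]
      exact hs.2
    rw [Metric.mem_closedBall, dist_zero_right, Real.norm_eq_abs,
      abs_of_nonneg (mul_nonneg (inv_nonneg.2 hR0.le) hs.1)]
    exact this
end
end

section
/- Let V*(r) = 1/( 4 r² (log(1/r))² · max{ √(log(1/r)), 1 } ) for r ∈ (0,1). Then the quadratic form Q_{V*} is nonnegative on C_c^∞(B) and is weakly coercive. -/
open MeasureTheory Real Set Filter
open scoped ENNReal

noncomputable section

/-- The potential `V*(r) = 1/(4 r² (log(1/r))² max{√(log(1/r)), 1})`. -/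
def Vstar : ℝ → ℝ := fun r =>
  1 / (4 * r ^ 2 * Real.log (1 / r) ^ 2 * max (Real.sqrt (Real.log (1 / r))) 1)

/-- The critical Hardy (Leray) potential of the unit disk. -/
def lerayPotential (r : ℝ) : ℝ := 1 / (4 * r ^ 2 * Real.log (1 / r) ^ 2)

lemma lerayPotential_nonneg (r : ℝ) : 0 ≤ lerayPotential r := by
  unfold lerayPotential
  positivity

lemma measurable_lerayPotential : Measurable lerayPotential := by
  unfold lerayPotential
  fun_prop

lemma measurable_Vstar : Measurable Vstar := by
  unfold Vstar
  fun_prop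

lemma Vstar_nonneg (r : ℝ) : 0 ≤ Vstar r := by
  unfold Vstar
  positivity

lemma Vstar_eq_lerayPotential_div (r : ℝ) :
    Vstar r = lerayPotential r / max (√(Real.log (1 / r))) 1 := by
  rw [Vstar, lerayPotential, div_div]

lemma Vstar_le_lerayPotential (r : ℝ) : Vstar r ≤ lerayPotential r := by
  rw [Vstar_eq_lerayPotential_div]
  exact div_le_self (lerayPotential_nonneg r) (le_max_right _ _)

lemma Vstar_add_le_lerayPotential {r : ℝ} (h0 : 0 < r) (h1 : r < Real.exp (-4)) :
    Vstar r + 1 / 8 ≤ lerayPotential r := by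
  have hL : 4 < Real.log (1 / r) := by
    rw [one_div, Real.log_inv]
    linarith [(Real.log_lt_iff_lt_exp h0).2 h1]
  have hrL : r * Real.log (1 / r) ≤ 1 := by
    have h := mul_le_mul_of_nonneg_left (Real.log_le_sub_one_of_pos (x := 1 / r) (by positivity))
      h0.le
    rw [mul_sub, mul_one_div_cancel h0.ne'] at h
    linarith
  have hm : 2 ≤ max (√(Real.log (1 / r))) 1 :=
    le_max_of_le_left (Real.le_sqrt_of_sq_le (by linarith))
  have hH : 1 / 4 ≤ lerayPotential r := by
    unfold lerayPotential
    have : 0 < r * Real.log (1 / r) := by positivity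
    apply one_div_le_one_div_of_le (by positivity)
    nlinarith
  have hV : Vstar r ≤ lerayPotential r / 2 := by
    rw [Vstar_eq_lerayPotential_div]
    exact div_le_div_of_nonneg_left (lerayPotential_nonneg r) two_pos hm
  linarith

/-- Integration in polar coordinates on the plane. -/
lemma lintegral_eq_lintegral_toSphere {g : E2 → ℝ≥0∞} (hg : Measurable g) :
    ∫⁻ x, g x = ∫⁻ ω : Metric.sphere (0 : E2) 1,
      (∫⁻ r in Ioi (0 : ℝ), ENNReal.ofReal r * g (r • (ω : E2)))
        ∂(volume : Measure E2).toSphere := by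
  have hmp := (volume : Measure E2).measurePreserving_homeomorphUnitSphereProd
  have hdim : Module.finrank ℝ E2 - 1 = 1 := by simp
  rw [hdim] at hmp
  have hg' : Measurable fun p : Metric.sphere (0 : E2) 1 × Ioi (0 : ℝ) =>
      g ((p.2 : ℝ) • (p.1 : E2)) := by fun_prop
  have h1 : ∫⁻ x, g x = ∫⁻ x : ({0}ᶜ : Set E2), g x ∂(volume.comap Subtype.val) := by
    rw [lintegral_subtype_comap (measurableSet_singleton _).compl, restrict_compl_singleton]
  have h2 : ∀ x : ({0}ᶜ : Set E2), g x = (fun p : Metric.sphere (0 : E2) 1 × Ioi (0 : ℝ) =>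
      g ((p.2 : ℝ) • (p.1 : E2))) (homeomorphUnitSphereProd E2 x) := by
    intro x
    have hx : ‖(x : E2)‖ ≠ 0 := norm_ne_zero_iff.2 x.2
    simp [smul_smul, hx]
  rw [h1, lintegral_congr h2, hmp.lintegral_comp hg', lintegral_prod _ hg'.aemeasurable]
  refine lintegral_congr fun ω => ?_
  rw [Measure.volumeIoiPow, lintegral_withDensity_eq_lintegral_mul _ (by fun_prop) (by fun_prop),
    ← lintegral_subtype_comap measurableSet_Ioi]
  simp

lemma intervalIntegral_lerayPotential_le {f f' : ℝ → ℝ} {a b : ℝ} (hf : ∀ r, HasDerivAt f (f' r) r)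
    (hf' : Continuous f') (ha : 0 < a) (hab : a ≤ b) (hb : b < 1) (hfb : f b = 0) :
    IntervalIntegrable (fun r => r * (lerayPotential r * f r ^ 2)) volume a b ∧
      ∫ r in a..b, r * (lerayPotential r * f r ^ 2) ≤ ∫ r in a..b, r * f' r ^ 2 := by
  have hfc : Continuous f := continuous_iff_continuousAt.2 fun r => (hf r).continuousAt
  have hpos : ∀ r ∈ uIcc a b, 0 < r ∧ 0 < -Real.log r := by
    intro r hr
    rw [uIcc_of_le hab] at hr
    have h0 : 0 < r := ha.trans_le hr.1
    exact ⟨h0, neg_pos.2 (Real.log_neg h0 (hr.2.trans_lt hb))⟩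
  have hlog : ContinuousOn (fun r => Real.log r) (uIcc a b) :=
    Real.continuousOn_log.mono fun r hr => (hpos r hr).1.ne'
  have hH : ContinuousOn lerayPotential (uIcc a b) := by
    unfold lerayPotential
    simp only [one_div, Real.log_inv]
    refine ContinuousOn.inv₀ (by fun_prop) fun r hr => ?_
    obtain ⟨h0, hl⟩ := hpos r hr
    positivity
  have hint : IntervalIntegrable (fun r => r * (lerayPotential r * f r ^ 2)) volume a b :=
    ContinuousOn.intervalIntegrable (by fun_prop)
  have hint' : IntervalIntegrable (fun r => r * f' r ^ 2) volume a b :=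
    Continuous.intervalIntegrable (by fun_prop) _ _
  have hderiv : ∀ r ∈ uIcc a b, HasDerivAt (fun r => f r ^ 2 / (2 * -Real.log r))
      (f r * f' r / (-Real.log r) + 2 * (r * (lerayPotential r * f r ^ 2))) r := by
    intro r hr
    obtain ⟨h0, hl⟩ := hpos r hr
    have : Real.log r ≠ 0 := by linarith
    refine (((hf r).pow 2).div ((Real.hasDerivAt_log h0.ne').neg.const_mul 2)
      (by simpa using this)).congr_deriv ?_
    simp only [lerayPotential, one_div, Real.log_inv, Pi.pow_apply, Pi.neg_apply]
    field_simp
    push_cast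
    ring
  have hcont : ContinuousOn (fun r => f r * f' r / (-Real.log r)
      + 2 * (r * (lerayPotential r * f r ^ 2))) (uIcc a b) := by
    refine ContinuousOn.add (ContinuousOn.div (by fun_prop) (by fun_prop) ?_) (by fun_prop)
    exact fun r hr => (hpos r hr).2.ne'
  have hftc := intervalIntegral.integral_eq_sub_of_hasDerivAt hderiv hcont.intervalIntegrable
  have hend : 0 ≤ f a ^ 2 / (2 * -Real.log a) := by
    have := (hpos a left_mem_uIcc).2
    positivity
  have hmono : ∫ r in a..b, (r * (lerayPotential r * f r ^ 2) - (f r * f' r / (-Real.log r)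
      + 2 * (r * (lerayPotential r * f r ^ 2)))) ≤ ∫ r in a..b, r * f' r ^ 2 := by
    refine intervalIntegral.integral_mono_on hab (hint.sub hcont.intervalIntegrable) hint' ?_
    intro r hr
    obtain ⟨h0, hl⟩ := hpos r (by rwa [uIcc_of_le hab])
    have hsq : r * f' r ^ 2 - (r * (lerayPotential r * f r ^ 2) - (f r * f' r / (-Real.log r)
        + 2 * (r * (lerayPotential r * f r ^ 2)))) =
        r * (f' r + f r / (2 * r * -Real.log r)) ^ 2 := by
      have : Real.log r ≠ 0 := by linarith
      simp only [lerayPotential, one_div, Real.log_inv]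
      field_simp
      ring
    have : 0 ≤ r * (f' r + f r / (2 * r * -Real.log r)) ^ 2 := by positivity
    linarith
  have hfb' : f b ^ 2 / (2 * -Real.log b) = 0 := by simp [hfb]
  rw [intervalIntegral.integral_sub hint hcont.intervalIntegrable, hftc, hfb'] at hmono
  exact ⟨hint, by linarith⟩

lemma lintegral_lerayPotential_le {f f' : ℝ → ℝ} {b : ℝ} (hf : ∀ r, HasDerivAt f (f' r) r)
    (hf' : Continuous f') (hb0 : 0 < b) (hb : b < 1) (hfb : ∀ r, b ≤ r → f r = 0) :
    ∫⁻ r in Ioi (0 : ℝ), ENNReal.ofReal (r * (lerayPotential r * f r ^ 2)) ≤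
      ∫⁻ r in Ioi (0 : ℝ), ENNReal.ofReal (r * f' r ^ 2) := by
  have hunion : ⋃ n : ℕ, Ioc (b / (n + 1)) b = Ioc 0 b := by
    ext r
    simp only [mem_iUnion, mem_Ioc]
    constructor
    · rintro ⟨n, h1, h2⟩
      exact ⟨lt_of_le_of_lt (by positivity) h1, h2⟩
    · rintro ⟨h1, h2⟩
      obtain ⟨n, hn⟩ := exists_nat_gt (b / r)
      refine ⟨n, ?_, h2⟩
      rw [div_lt_iff₀ h1] at hn
      rw [div_lt_iff₀ (by positivity)]
      nlinarith
  have hdir : Directed (· ⊆ ·) fun n : ℕ => Ioc (b / (n + 1 : ℝ)) b := by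
    refine Monotone.directed_le fun m n hmn => Ioc_subset_Ioc_left ?_
    gcongr
  have hsupp : ∫⁻ r in Ioi (0 : ℝ), ENNReal.ofReal (r * (lerayPotential r * f r ^ 2)) =
      ∫⁻ r in Ioc 0 b, ENNReal.ofReal (r * (lerayPotential r * f r ^ 2)) := by
    rw [← Ioc_union_Ioi_eq_Ioi hb0.le, lintegral_union measurableSet_Ioi (Ioc_disjoint_Ioi le_rfl),
      setLIntegral_eq_zero measurableSet_Ioi fun r hr => by simp [hfb r (le_of_lt hr)], add_zero]
  rw [hsupp, ← hunion, setLIntegral_iUnion_of_directed _ hdir]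
  refine iSup_le fun n => ?_
  have ha : 0 < b / (n + 1 : ℝ) := by positivity
  have hab : b / (n + 1 : ℝ) ≤ b := div_le_self hb0.le (by simp)
  obtain ⟨hint, hle⟩ := intervalIntegral_lerayPotential_le hf hf' ha hab hb (hfb b le_rfl)
  rw [intervalIntegral.integral_of_le hab, intervalIntegral.integral_of_le hab] at hle
  have hae : ∀ g : ℝ → ℝ, (∀ r, 0 ≤ g r) →
      0 ≤ᵐ[volume.restrict (Ioc (b / (n + 1 : ℝ)) b)] fun r => r * g r := by
    intro g hg
    filter_upwards [ae_restrict_mem measurableSet_Ioc] with r hr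
    exact mul_nonneg (ha.trans hr.1).le (hg r)
  have hint' : IntegrableOn (fun r => r * f' r ^ 2) (Ioc (b / (n + 1 : ℝ)) b) :=
    (Continuous.intervalIntegrable (by fun_prop) _ _).1
  calc ∫⁻ r in Ioc (b / (n + 1 : ℝ)) b, ENNReal.ofReal (r * (lerayPotential r * f r ^ 2))
      = ENNReal.ofReal (∫ r in Ioc (b / (n + 1 : ℝ)) b, r * (lerayPotential r * f r ^ 2)) :=
        (ofReal_integral_eq_lintegral_ofReal hint.1 (hae _ fun r =>
          mul_nonneg (lerayPotential_nonneg r) (sq_nonneg _))).symm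
    _ ≤ ENNReal.ofReal (∫ r in Ioc (b / (n + 1 : ℝ)) b, r * f' r ^ 2) :=
        ENNReal.ofReal_le_ofReal hle
    _ = ∫⁻ r in Ioc (b / (n + 1 : ℝ)) b, ENNReal.ofReal (r * f' r ^ 2) :=
        ofReal_integral_eq_lintegral_ofReal hint' (hae _ fun r => sq_nonneg _)
    _ ≤ _ := lintegral_mono_set fun r hr => ha.trans hr.1

lemma IsTestFun.exists_radius {u : E2 → ℝ} (hu : IsTestFun unitDisk u) :
    ∃ b, 0 < b ∧ b < 1 ∧ ∀ x, b ≤ ‖x‖ → u x = 0 := by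
  obtain ⟨b, hb, hsub⟩ := exists_pos_lt_subset_ball one_pos hu.2.1.isClosed hu.2.2
  refine ⟨b, hb.1, hb.2, fun x hx => image_eq_zero_of_notMem_tsupport fun h => ?_⟩
  have := hsub h
  rw [mem_ball_zero_iff] at this
  linarith

/-- Leray's inequality on the unit disk. -/
lemma lintegral_leray {u : E2 → ℝ} (hu : IsTestFun unitDisk u) :
    ∫⁻ x, ENNReal.ofReal (lerayPotential ‖x‖ * u x ^ 2) ≤
      ∫⁻ x, ENNReal.ofReal (‖fderiv ℝ u x‖ ^ 2) := by
  obtain ⟨b, hb0, hb, hub⟩ := hu.exists_radius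
  have hdiff : Differentiable ℝ u := hu.1.differentiable (by simp)
  have huc : Continuous u := hdiff.continuous
  have hfc : Continuous (fderiv ℝ u) := hu.1.continuous_fderiv (by simp)
  have hH := measurable_lerayPotential
  rw [lintegral_eq_lintegral_toSphere (by fun_prop), lintegral_eq_lintegral_toSphere (by fun_prop)]
  refine lintegral_mono fun ω => ?_
  have hω : ‖(ω : E2)‖ = 1 := by simp
  have hf : ∀ r : ℝ, HasDerivAt (fun r : ℝ => u (r • (ω : E2)))
      (fderiv ℝ u (r • (ω : E2)) ω) r := by
    intro r
    have h := (hasDerivAt_id r).smul_const (ω : E2)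
    rw [one_smul] at h
    exact (hdiff (r • (ω : E2))).hasFDerivAt.comp_hasDerivAt r h
  have key := lintegral_lerayPotential_le hf (by fun_prop) hb0 hb fun r hr => hub _ (by
    rw [norm_smul, hω, mul_one]
    exact hr.trans (le_abs_self r))
  calc _ = ∫⁻ r in Ioi (0 : ℝ),
        ENNReal.ofReal (r * (lerayPotential r * u (r • (ω : E2)) ^ 2)) := by
        refine setLIntegral_congr_fun measurableSet_Ioi fun r (hr : 0 < r) => ?_
        simp only [norm_smul, hω, mul_one, Real.norm_of_nonneg hr.le]
        rw [ENNReal.ofReal_mul hr.le]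
    _ ≤ _ := key
    _ ≤ _ := by
        refine setLIntegral_mono (by fun_prop) fun r (hr : 0 < r) => ?_
        rw [ENNReal.ofReal_mul hr.le]
        gcongr 1
        refine ENNReal.ofReal_le_ofReal ?_
        have := (fderiv ℝ u (r • (ω : E2))).le_opNorm (ω : E2)
        rw [hω, mul_one, Real.norm_eq_abs] at this
        rw [← sq_abs]
        gcongr

lemma sq_integral_le {α : Type*} [MeasurableSpace α] {μ : Measure α} [IsFiniteMeasure μ]
    {u : α → ℝ} (hu : Integrable u μ) (hu2 : Integrable (fun x => u x ^ 2) μ) :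
    (∫ x, u x ∂μ) ^ 2 ≤ (μ.real univ + 1) * ∫ x, u x ^ 2 ∂μ := by
  set m := μ.real univ
  have hm : 0 ≤ m := measureReal_nonneg
  set I := ∫ x, u x ∂μ
  set c := I / (m + 1)
  have hI : I = c * (m + 1) := by simp only [c]; field_simp
  have h : 0 ≤ ∫ x, (u x - c) ^ 2 ∂μ := integral_nonneg fun x => sq_nonneg _
  have heq : ∫ x, (u x - c) ^ 2 ∂μ = ∫ x, u x ^ 2 ∂μ - 2 * c * I + m * c ^ 2 := by
    have hfun : (fun x => (u x - c) ^ 2) = fun x => u x ^ 2 - 2 * c * u x + c ^ 2 := by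
      ext x
      ring
    have hi : Integrable (fun x => u x ^ 2 - 2 * c * u x) μ := hu2.sub (hu.const_mul _)
    rw [hfun, integral_add hi (integrable_const _),
      integral_sub hu2 (hu.const_mul _), integral_const_mul, integral_const, smul_eq_mul]
  rw [heq, hI] at h
  rw [hI]
  have : c ^ 2 * (m + 1) ≤ ∫ x, u x ^ 2 ∂μ := by nlinarith [sq_nonneg c]
  nlinarith

/-- The punctured disk of radius `exp (-4)`. -/
def smallDisk : Set E2 := Metric.ball 0 (Real.exp (-4)) \ {0}

lemma isOpen_smallDisk : IsOpen smallDisk := Metric.isOpen_ball.sdiff isClosed_singleton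

lemma closure_smallDisk_subset : closure smallDisk ⊆ Metric.closedBall 0 (Real.exp (-4)) :=
  closure_minimal (sdiff_subset.trans Metric.ball_subset_closedBall) Metric.isClosed_closedBall

lemma closedBall_exp_subset_unitDisk :
    Metric.closedBall (0 : E2) (Real.exp (-4)) ⊆ unitDisk :=
  Metric.closedBall_subset_ball (by simp)

lemma integral_sq_smallDisk_le {u : E2 → ℝ} (hu : IsTestFun unitDisk u) :
    1 / 8 * ∫ x in smallDisk, u x ^ 2 ≤ QV Vstar u := by
  have huc : Continuous u := hu.1.continuous
  have hfc : Continuous (fderiv ℝ u) := hu.1.continuous_fderiv (by simp)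
  have hcs : HasCompactSupport u := hu.2.1
  have hH := measurable_lerayPotential
  have hV := measurable_Vstar
  have hu2 : Integrable fun x => u x ^ 2 :=
    Continuous.integrable_of_hasCompactSupport (by fun_prop)
      (hcs.comp_left (g := fun y : ℝ => y ^ 2) (by simp))
  have hgrad : Integrable fun x => ‖fderiv ℝ u x‖ ^ 2 :=
    Continuous.integrable_of_hasCompactSupport (by fun_prop)
      ((hcs.fderiv (𝕜 := ℝ)).comp_left (g := fun L : E2 →L[ℝ] ℝ => ‖L‖ ^ 2) (by simp))
  have hgradfin : ∫⁻ x, ENNReal.ofReal (‖fderiv ℝ u x‖ ^ 2) < ⊤ := by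
    rw [← ofReal_integral_eq_lintegral_ofReal hgrad (.of_forall fun x => by positivity)]
    exact ENNReal.ofReal_lt_top
  have hHn : ∀ x, 0 ≤ lerayPotential ‖x‖ * u x ^ 2 := fun x : E2 =>
    mul_nonneg (lerayPotential_nonneg _) (sq_nonneg _)
  have hHint : Integrable fun x => lerayPotential ‖x‖ * u x ^ 2 := by
    refine ⟨(by fun_prop : Measurable _).aestronglyMeasurable, ?_⟩
    rw [hasFiniteIntegral_iff_ofReal (.of_forall hHn)]
    exact (lintegral_leray hu).trans_lt hgradfin
  have hVint : Integrable fun x => Vstar ‖x‖ * u x ^ 2 := by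
    refine hHint.mono' (by fun_prop : Measurable _).aestronglyMeasurable (.of_forall fun x => ?_)
    rw [Real.norm_of_nonneg (mul_nonneg (Vstar_nonneg _) (sq_nonneg _))]
    exact mul_le_mul_of_nonneg_right (Vstar_le_lerayPotential _) (sq_nonneg _)
  have hHle : ∫ x, lerayPotential ‖x‖ * u x ^ 2 ≤ ∫ x, ‖fderiv ℝ u x‖ ^ 2 := by
    rw [integral_eq_lintegral_of_nonneg_ae (.of_forall hHn) hHint.1,
      integral_eq_lintegral_of_nonneg_ae (.of_forall fun x => by positivity) hgrad.1]
    exact ENNReal.toReal_mono hgradfin.ne (lintegral_leray hu)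
  have hout : ∀ x, x ∉ unitDisk → x ∉ tsupport u := fun x hx h => hx (hu.2.2 h)
  have hQ : QV Vstar u = (∫ x, ‖fderiv ℝ u x‖ ^ 2) - ∫ x, Vstar ‖x‖ * u x ^ 2 := by
    rw [QV, setIntegral_eq_integral_of_forall_compl_eq_zero fun x hx => ?_,
      setIntegral_eq_integral_of_forall_compl_eq_zero fun x hx => ?_]
    · simp [image_eq_zero_of_notMem_tsupport (hout x hx)]
    · simp [fderiv_of_notMem_tsupport ℝ (hout x hx)]
  have hm : MeasurableSet smallDisk := isOpen_smallDisk.measurableSet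
  have hsum : (∫ x, Vstar ‖x‖ * u x ^ 2) + ∫ x, smallDisk.indicator (fun x => 1 / 8 * u x ^ 2) x
      ≤ ∫ x, lerayPotential ‖x‖ * u x ^ 2 := by
    have hi : Integrable (smallDisk.indicator fun x => 1 / 8 * u x ^ 2) :=
      (hu2.const_mul _).indicator hm
    rw [← integral_add hVint hi]
    refine integral_mono (hVint.add hi) hHint fun x => ?_
    by_cases hx : x ∈ smallDisk
    · have hx0 : 0 < ‖x‖ := norm_pos_iff.2 hx.2
      have := Vstar_add_le_lerayPotential hx0 (mem_ball_zero_iff.1 hx.1)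
      simp only [indicator_of_mem hx, ← add_mul]
      gcongr
    · simp only [indicator_of_notMem hx, add_zero]
      exact mul_le_mul_of_nonneg_right (Vstar_le_lerayPotential _) (sq_nonneg _)
  rw [integral_indicator hm, integral_const_mul] at hsum
  rw [hQ]
  linarith

/-- `Q_{V*}` is nonnegative on `C_c^∞(B)` and weakly coercive. -/
theorem Vstar_nonneg_weaklyCoercive :
    (∀ u : E2 → ℝ, IsTestFun unitDisk u → 0 ≤ QV Vstar u) ∧ WeaklyCoercive Vstar := by
  refine ⟨fun u hu => le_trans ?_ (integral_sq_smallDisk_le hu), smallDisk, isOpen_smallDisk,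
    (isCompact_closedBall _ _).of_isClosed_subset isClosed_closure closure_smallDisk_subset,
    closure_smallDisk_subset.trans closedBall_exp_subset_unitDisk,
    (8 * (volume.real smallDisk + 1))⁻¹, by positivity, fun u hu => ?_⟩
  · exact mul_nonneg (by norm_num) (integral_nonneg fun x => sq_nonneg _)
  · have huc : Continuous u := hu.1.continuous
    have : IsFiniteMeasure (volume.restrict smallDisk) :=
      ⟨by
        rw [Measure.restrict_apply_univ]
        exact (measure_mono sdiff_subset).trans_lt measure_ball_lt_top⟩
    have hu1 : Integrable u := huc.integrable_of_hasCompactSupport hu.2.1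
    have hu2 : Integrable fun x => u x ^ 2 :=
      Continuous.integrable_of_hasCompactSupport (by fun_prop)
        (HasCompactSupport.comp_left (g := fun y : ℝ => y ^ 2) hu.2.1 (by simp))
    have h := sq_integral_le (hu1.restrict (s := smallDisk)) (hu2.restrict (s := smallDisk))
    rw [measureReal_restrict_apply_univ] at h
    refine le_trans ?_ (integral_sq_smallDisk_le hu)
    rw [inv_mul_le_iff₀ (by positivity)]
    linarith
end
end

section
/- Let φ : [0,1) → ℝ be continuously differentiable with φ(0) = 1 and 0 < φ(t) ≤ 1 for all t ∈ [0,1), and define s(r) = exp( ∫_{1/e}^{r} dt/(t φ(t)²) ) for r ∈ (0,1). Then: (i) s is strictly increasing and continuously differentiable on (0,1) with s'(r)/s(r) = 1/(r φ(r)²); (ii) the function r ↦ s(r)/r is nondecreasing on (0,1); (iii) the limit γ = lim_{r→0⁺} s(r)/r exists, is finite and is positive. -/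
open MeasureTheory Real Set Filter

noncomputable section

/-- Derivative of `r ↦ ∫_c^r dt/(t φ(t)²)` on `(0,1)`. -/
theorem hasDerivAt_integral_one_div_mul_sq {φ : ℝ → ℝ} (hφ : ContinuousOn φ (Ioo 0 1))
    (hpos : ∀ t ∈ Ioo (0:ℝ) 1, 0 < φ t) {c r : ℝ} (hc : c ∈ Ioo (0:ℝ) 1) (hr : r ∈ Ioo (0:ℝ) 1) :
    HasDerivAt (fun r => ∫ t in c..r, 1 / (t * φ t ^ 2)) (1 / (r * φ r ^ 2)) r := by
  have hg : ContinuousOn (fun t => 1 / (t * φ t ^ 2)) (Ioo 0 1) :=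
    continuousOn_const.div (continuousOn_id.mul (hφ.pow 2))
      fun t ht => (mul_pos ht.1 (pow_pos (hpos t ht) 2)).ne'
  have hsub : uIcc c r ⊆ Ioo 0 1 := ordConnected_Ioo.uIcc_subset hc hr
  exact intervalIntegral.integral_hasDerivAt_right (hg.mono hsub).intervalIntegrable
    (hg.stronglyMeasurableAtFilter isOpen_Ioo r hr) (hg.continuousAt (isOpen_Ioo.mem_nhds hr))

/-- If `φ` is differentiable from the right at `0` with `φ(0) = 1`, then
`1/(t φ(t)²) - 1/t` is bounded above near `0⁺`. -/
theorem exists_forall_one_div_mul_sq_sub_inv_le {φ : ℝ → ℝ}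
    (hφ : DifferentiableWithinAt ℝ φ (Ico 0 1) 0) (hφ0 : φ 0 = 1) :
    ∃ K : ℝ, ∃ d ∈ Ioo (0:ℝ) 1, ∀ t ∈ Ioo 0 d, 1 / (t * φ t ^ 2) - t⁻¹ ≤ K := by
  have hfilter : nhdsWithin (0:ℝ) (Ioi 0) ≤ nhdsWithin 0 (Ico 0 1) :=
    (nhdsWithin_Ioo_eq_nhdsGT (zero_lt_one' ℝ)).symm.trans_le
      (nhdsWithin_mono 0 Ioo_subset_Ico_self)
  obtain ⟨M, hM⟩ := (hφ.isBigO_sub.mono hfilter).bound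
  have hhalf : ∀ᶠ t in nhdsWithin (0:ℝ) (Ioi 0), 1 / 2 < φ t :=
    (hφ.continuousWithinAt.tendsto.mono_left hfilter).eventually
      (lt_mem_nhds (by rw [hφ0]; norm_num))
  obtain ⟨u, hu0, hu⟩ := mem_nhdsGT_iff_exists_Ioo_subset.1 (hM.and hhalf)
  rw [mem_Ioi] at hu0
  refine ⟨12 * M, min u (1 / 2), ⟨by positivity, by
    exact (min_le_right _ _).trans_lt (by norm_num)⟩, fun t ht => ?_⟩
  obtain ⟨hMt, hht⟩ := hu ⟨ht.1, ht.2.trans_le (min_le_left _ _)⟩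
  have ht0 := ht.1
  rw [hφ0, sub_zero, Real.norm_eq_abs, Real.norm_eq_abs, abs_of_pos ht0] at hMt
  have hM0 : 0 ≤ M * t := (abs_nonneg _).trans hMt
  have hlow : 1 - φ t ≤ M * t := by linarith [neg_abs_le (φ t - 1)]
  have hφt : 0 < φ t := by linarith
  have hkey : 1 / (t * φ t ^ 2) - t⁻¹ = (1 - φ t ^ 2) / (t * φ t ^ 2) := by
    field_simp
  rw [hkey, div_le_iff₀ (by positivity)]
  have h1 : 1 - φ t ^ 2 ≤ M * t * (1 + φ t) := by nlinarith
  have h2 : 1 + φ t ≤ 12 * φ t ^ 2 := by nlinarith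
  nlinarith [mul_le_mul_of_nonneg_left h2 hM0]

/-- properties of `s(r) = exp(∫_{1/e}^r dt/(t φ(t)²))` for a `C¹` function
`φ : [0,1) → ℝ` with `φ(0) = 1` and `0 < φ ≤ 1`:
(i) `s` is strictly increasing and continuously differentiable on `(0,1)` with
`s'(r)/s(r) = 1/(r φ(r)²)`; (ii) `r ↦ s(r)/r` is nondecreasing on `(0,1)`;
(iii) `γ = lim_{r→0⁺} s(r)/r` exists, is finite and positive. -/
theorem sMap_properties (φ : ℝ → ℝ) (hφ : ContDiffOn ℝ 1 φ (Ico 0 1))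
    (hφ0 : φ 0 = 1) (hφpos : ∀ t ∈ Ico (0:ℝ) 1, 0 < φ t) (hφle : ∀ t ∈ Ico (0:ℝ) 1, φ t ≤ 1) :
    (StrictMonoOn (fun r => Real.exp (∫ t in (Real.exp (-1))..r, 1 / (t * φ t ^ 2)))
        (Ioo 0 1) ∧
      (∀ r ∈ Ioo (0:ℝ) 1,
        HasDerivAt (fun r => Real.exp (∫ t in (Real.exp (-1))..r, 1 / (t * φ t ^ 2)))
          (Real.exp (∫ t in (Real.exp (-1))..r, 1 / (t * φ t ^ 2)) / (r * φ r ^ 2)) r) ∧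
      ContinuousOn
        (fun r => Real.exp (∫ t in (Real.exp (-1))..r, 1 / (t * φ t ^ 2)) / (r * φ r ^ 2))
        (Ioo 0 1)) ∧
    MonotoneOn
      (fun r => Real.exp (∫ t in (Real.exp (-1))..r, 1 / (t * φ t ^ 2)) / r) (Ioo 0 1) ∧
    ∃ γ : ℝ, 0 < γ ∧
      Tendsto (fun r => Real.exp (∫ t in (Real.exp (-1))..r, 1 / (t * φ t ^ 2)) / r)
        (nhdsWithin 0 (Ioi 0)) (nhds γ) := by
  have hIoo : ∀ t ∈ Ioo (0:ℝ) 1, t ∈ Ico (0:ℝ) 1 := fun t ht => Ioo_subset_Ico_self ht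
  have hc : Real.exp (-1) ∈ Ioo (0:ℝ) 1 := ⟨Real.exp_pos _, by simp⟩
  have hcont : ContinuousOn φ (Ioo 0 1) := hφ.continuousOn.mono Ioo_subset_Ico_self
  set F : ℝ → ℝ := fun r => ∫ t in (Real.exp (-1))..r, 1 / (t * φ t ^ 2) with hF
  have hF' : ∀ r ∈ Ioo (0:ℝ) 1, HasDerivAt F (1 / (r * φ r ^ 2)) r := fun r hr =>
    hasDerivAt_integral_one_div_mul_sq hcont (fun t ht => hφpos t (hIoo t ht)) hc hr
  have hden : ∀ r ∈ Ioo (0:ℝ) 1, 0 < r * φ r ^ 2 := fun r hr =>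
    mul_pos hr.1 (pow_pos (hφpos r (hIoo r hr)) 2)
  have hs' : ∀ r ∈ Ioo (0:ℝ) 1,
      HasDerivAt (fun r => Real.exp (F r)) (Real.exp (F r) / (r * φ r ^ 2)) r := fun r hr => by
    simpa only [mul_one_div] using (hF' r hr).exp
  have hscont : ContinuousOn (fun r => Real.exp (F r)) (Ioo 0 1) := fun r hr =>
    (hs' r hr).continuousAt.continuousWithinAt
  have hL' : ∀ r ∈ Ioo (0:ℝ) 1,
      HasDerivAt (fun r => F r - Real.log r) (1 / (r * φ r ^ 2) - r⁻¹) r := fun r hr =>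
    (hF' r hr).sub (Real.hasDerivAt_log hr.1.ne')
  have hLmono : MonotoneOn (fun r => F r - Real.log r) (Ioo 0 1) := by
    refine monotoneOn_of_deriv_nonneg (convex_Ioo 0 1)
      (fun r hr => (hL' r hr).continuousAt.continuousWithinAt)
      (fun r hr => (hL' r (interior_subset hr)).differentiableAt.differentiableWithinAt)
      fun r hr => ?_
    replace hr := interior_subset hr
    rw [(hL' r hr).deriv, sub_nonneg, ← one_div]
    exact one_div_le_one_div_of_le (hden r hr) (mul_le_of_le_one_right hr.1.le
      (pow_le_one₀ (hφpos r (hIoo r hr)).le (hφle r (hIoo r hr))))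
  have hexp : ∀ r ∈ Ioo (0:ℝ) 1, Real.exp (F r - Real.log r) = Real.exp (F r) / r := fun r hr => by
    rw [Real.exp_sub, Real.exp_log hr.1]
  have hbdd : BddBelow ((fun r => F r - Real.log r) '' Ioo 0 1) := by
    obtain ⟨K, d, hd, hK⟩ := exists_forall_one_div_mul_sq_sub_inv_le
      (hφ.differentiableOn one_ne_zero 0 ⟨le_rfl, zero_lt_one⟩) hφ0
    have hsub : ∀ t ∈ Ioo 0 d, t ∈ Ioo (0:ℝ) 1 := fun t ht => ⟨ht.1, ht.2.trans hd.2⟩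
    have hG' : ∀ r ∈ Ioo 0 d, HasDerivAt (fun r => F r - Real.log r - K * r)
        (1 / (r * φ r ^ 2) - r⁻¹ - K) r := fun r hr =>
      (hL' r (hsub r hr)).sub (hasDerivAt_const_mul K)
    have hanti : AntitoneOn (fun r => F r - Real.log r - K * r) (Ioo 0 d) := by
      refine antitoneOn_of_deriv_nonpos (convex_Ioo 0 d)
        (fun r hr => (hG' r hr).continuousAt.continuousWithinAt)
        (fun r hr => (hG' r (interior_subset hr)).differentiableAt.differentiableWithinAt)
        fun r hr => ?_
      replace hr := interior_subset hr
      rw [(hG' r hr).deriv]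
      exact sub_nonpos.2 (hK r hr)
    have hmid : d / 2 ∈ Ioo 0 d := ⟨half_pos hd.1, half_lt_self hd.1⟩
    refine ⟨F (d / 2) - Real.log (d / 2) - |K| * (d / 2), ?_⟩
    rintro _ ⟨r, hr, rfl⟩
    have hKd : 0 ≤ |K| * (d / 2) := mul_nonneg (abs_nonneg K) hmid.1.le
    rcases le_total r (d / 2) with h | h
    · have h1 := hanti ⟨hr.1, h.trans_lt hmid.2⟩ hmid h
      have h2 : K * (d / 2 - r) ≤ |K| * (d / 2) :=
        mul_le_mul (le_abs_self K) (sub_le_self _ hr.1.le) (sub_nonneg.2 h) (abs_nonneg K)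
      dsimp only at h1 ⊢
      linarith
    · have h1 := hLmono (hsub _ hmid) hr h
      dsimp only at h1 ⊢
      linarith
  refine ⟨⟨?_, hs', ?_⟩, ?_, ?_⟩
  · refine strictMonoOn_of_deriv_pos (convex_Ioo 0 1) hscont fun r hr => ?_
    replace hr := interior_subset hr
    rw [(hs' r hr).deriv]
    exact div_pos (Real.exp_pos _) (hden r hr)
  · exact hscont.div (continuousOn_id.mul (hcont.pow 2)) fun r hr => (hden r hr).ne'
  · exact (Real.exp_monotone.comp_monotoneOn hLmono).congr hexp
  · refine ⟨_, Real.exp_pos _, ((Real.continuous_exp.tendsto _).comp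
      (hLmono.tendsto_nhdsWithin_Ioo_right (nonempty_Ioo.2 zero_lt_one) hbdd)).congr' ?_⟩
    filter_upwards [Ioo_mem_nhdsGT (zero_lt_one' ℝ)] with r hr using hexp r hr
end
end
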